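/- arXiv:math/0609437 — 3 statements merged into one kernel-verified Lean document; each statement's English description precedes it below -/
import Mathlib

section
/- Let (A,m) be a Noetherian local ring that is a quotient of a Gorenstein local ring R of dimension n, and M a finitely generated A-module of dimension d ≥ 2 with depth(M) = d-1 and dim D^{d-1}(M) = d-2, where D^i(M) = Ext_R^{n-i}(M,R). Then depth D^{d-1}(M) = depth K_M − 2, where K_M = D^d(M) is the canonical module. -/
open CategoryTheory

noncomputable section

/-- The dimension of a module: Krull dimension of its support. -/
def moduleDim (R : Type) [CommRing R] (M : Type) [AddCommGroup M] [Module R M] :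
    WithBot (WithTop ℕ) :=
  Order.krullDim (Module.support R M)

/-- The depth of a module over a local ring: supremum of lengths of regular
sequences on `M` contained in the maximal ideal. -/
def moduleDepth (R : Type) [CommRing R] [IsLocalRing R] (M : Type) [AddCommGroup M]
    [Module R M] : ℕ∞ :=
  sSup {n : ℕ∞ | ∃ rs : List R, (rs.length : ℕ∞) = n ∧
    (∀ r ∈ rs, r ∈ IsLocalRing.maximalIdeal R) ∧ RingTheory.Sequence.IsRegular M rs}

/-- A module over a local ring is Cohen–Macaulay if it is zero or its depth
equals its (Krull) dimension. -/
def IsCM (R : Type) [CommRing R] [IsLocalRing R] (M : Type) [AddCommGroup M]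
    [Module R M] : Prop :=
  Subsingleton M ∨ moduleDim R M = (moduleDepth R M : WithBot ℕ∞)

/-- `extModule R n M N` is `Ext_R^n(M, N)` as an `R`-module object. -/
def extModule (R : Type) [CommRing R] (n : ℕ) (M N : Type) [AddCommGroup M] [Module R M]
    [AddCommGroup N] [Module R N] : ModuleCat R :=
  ((Ext R (ModuleCat R) n).obj (Opposite.op (ModuleCat.of R M))).obj (ModuleCat.of R N)

/-- A Noetherian local ring `R` of dimension `n` is Gorenstein if
`Ext^i(k, R)` vanishes for `i ≠ n` and is isomorphic to the residue field `k` for `i = n`. -/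
def IsGorensteinLocalRing (R : Type) [CommRing R] [IsLocalRing R] : Prop :=
  IsNoetherianRing R ∧
  ∀ n : ℕ, ringKrullDim R = n →
    (∀ i : ℕ, i ≠ n → Subsingleton ↥(extModule R i (IsLocalRing.ResidueField R) R)) ∧
    Nonempty (extModule R n (IsLocalRing.ResidueField R) R ≅
      ModuleCat.of R (IsLocalRing.ResidueField R))

namespace Aux
open CategoryTheory.Abelian RingTheory.Sequence IsLocalRing
open scoped Pointwise

variable {R : Type} [CommRing R]

/-- Vanishing of `Ext^j(X, Y)`. -/
def EV (R : Type) [CommRing R] (X Y : Type) [AddCommGroup X] [Module R X]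
    [AddCommGroup Y] [Module R Y] (j : ℕ) : Prop :=
  ∀ x : Abelian.Ext (ModuleCat.of R X) (ModuleCat.of R Y) j, x = 0

variable {T X Y Z : Type} [AddCommGroup T] [Module R T] [AddCommGroup X] [Module R X]
    [AddCommGroup Y] [Module R Y] [AddCommGroup Z] [Module R Z]

lemma ses {f : X →ₗ[R] Y} {g : Y →ₗ[R] Z} (hf : Function.Injective f)
    (hg : Function.Surjective g) (hfg : Function.Exact f g) :
    (ModuleCat.shortComplexOfCompEqZero f g hfg.linearMap_comp_eq_zero).ShortExact where
  exact := ModuleCat.shortComplex_exact _ hfg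
  mono_f := (ModuleCat.mono_iff_injective _).mpr hf
  epi_g := (ModuleCat.epi_iff_surjective _).mpr hg

section

lemma EV.mid {f : X →ₗ[R] Y} {g : Y →ₗ[R] Z} (hf : Function.Injective f)
    (hg : Function.Surjective g) (hfg : Function.Exact f g)
    {j : ℕ} (h1 : EV R T X j) (h3 : EV R T Z j) : EV R T Y j := fun y => by
  obtain ⟨x, rfl⟩ := Abelian.Ext.covariant_sequence_exact₂ _ (ses hf hg hfg) y (h3 _)
  rw [h1 x, Abelian.Ext.zero_comp]

lemma EV.right {f : X →ₗ[R] Y} {g : Y →ₗ[R] Z} (hf : Function.Injective f)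
    (hg : Function.Surjective g) (hfg : Function.Exact f g)
    {j : ℕ} (h2 : EV R T Y j) (h1 : EV R T X (j + 1)) : EV R T Z j := fun y => by
  obtain ⟨x, rfl⟩ := Abelian.Ext.covariant_sequence_exact₃ _ (ses hf hg hfg) y rfl (h1 _)
  rw [h2 x, Abelian.Ext.zero_comp]

lemma EV.left {f : X →ₗ[R] Y} {g : Y →ₗ[R] Z} (hf : Function.Injective f)
    (hg : Function.Surjective g) (hfg : Function.Exact f g)
    {j : ℕ} (h3 : EV R T Z j) (h2 : EV R T Y (j + 1)) : EV R T X (j + 1) := fun y => by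
  obtain ⟨x, rfl⟩ := Abelian.Ext.covariant_sequence_exact₁ _ (ses hf hg hfg) y (h2 _) rfl
  rw [h3 x, Abelian.Ext.zero_comp]

lemma EV.cmid {f : X →ₗ[R] Y} {g : Y →ₗ[R] Z} (hf : Function.Injective f)
    (hg : Function.Surjective g) (hfg : Function.Exact f g)
    {j : ℕ} (h1 : EV R X T j) (h3 : EV R Z T j) : EV R Y T j := fun y => by
  obtain ⟨x, rfl⟩ := Abelian.Ext.contravariant_sequence_exact₂ (ses hf hg hfg) _ y (h1 _)
  rw [h3 x, Abelian.Ext.comp_zero]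

end

lemma EV.zero_iff : EV R T X 0 ↔ Subsingleton (T →ₗ[R] X) := by
  let e : Abelian.Ext (ModuleCat.of R T) (ModuleCat.of R X) 0 ≃ₗ[R] (T →ₗ[R] X) :=
    (Abelian.Ext.linearEquiv₀ (R := R)).trans ModuleCat.homLinearEquiv
  constructor
  · intro h
    exact ⟨fun a b => e.symm.injective ((h _).trans (h _).symm)⟩
  · intro h x
    exact e.injective (Subsingleton.elim _ _)

lemma EV.left_zero {f : X →ₗ[R] Y} (hf : Function.Injective f) (h : EV R T Y 0) : EV R T X 0 := by
  rw [EV.zero_iff] at *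
  refine ⟨fun a b => ?_⟩
  ext t
  apply hf
  exact LinearMap.congr_fun (Subsingleton.elim (f.comp a) (f.comp b)) t

lemma EV.congr (e : X ≃ₗ[R] Y) {j : ℕ} (h : EV R T X j) : EV R T Y j := fun y => by
  have : y = (y.comp (Abelian.Ext.mk₀ e.toModuleIso.inv) (add_zero j)).comp
    (Abelian.Ext.mk₀ e.toModuleIso.hom) (add_zero j) := by
    rw [Abelian.Ext.comp_assoc_of_third_deg_zero, Abelian.Ext.mk₀_comp_mk₀, Iso.inv_hom_id,
      Abelian.Ext.comp_mk₀_id]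
  rw [this, h (y.comp (Abelian.Ext.mk₀ e.toModuleIso.inv) (add_zero j)), Abelian.Ext.zero_comp]

lemma EV.ccongr (e : X ≃ₗ[R] Y) {j : ℕ} (h : EV R X T j) : EV R Y T j := fun y => by
  have : y = (Abelian.Ext.mk₀ e.toModuleIso.inv).comp ((Abelian.Ext.mk₀ e.toModuleIso.hom).comp y
     (zero_add j)) (zero_add j) := by
    rw [Abelian.Ext.mk₀_comp_mk₀_assoc, Iso.inv_hom_id, Abelian.Ext.mk₀_id_comp]
  rw [this, h ((Abelian.Ext.mk₀ e.toModuleIso.hom).comp y (zero_add j)), Abelian.Ext.comp_zero]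

lemma EV.of_subsingleton [Subsingleton Y] (j : ℕ) : EV R T Y j := fun y => by
  rw [← Abelian.Ext.comp_mk₀_id y]
  have : 𝟙 (ModuleCat.of R Y) = 0 := by ext; exact Subsingleton.elim (α := Y) _ _
  rw [this]; simp

lemma EV.of_csubsingleton [Subsingleton Y] (j : ℕ) : EV R Y T j := fun y => by
  rw [← Abelian.Ext.mk₀_id_comp y]
  have : 𝟙 (ModuleCat.of R Y) = 0 := by ext; exact Subsingleton.elim (α := Y) _ _
  rw [this]; simp

lemma mk_comp {A B : ModuleCat.{0} R} {j : ℕ} (x : R) (z : Abelian.Ext A B j) :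
    (Abelian.Ext.mk₀ (x • 𝟙 A)).comp z (zero_add j) = x • z := by
  rw [Abelian.Ext.mk₀_smul, Abelian.Ext.smul_comp, Abelian.Ext.mk₀_id_comp]

lemma comp_mk {A B : ModuleCat.{0} R} {j : ℕ} (x : R) (z : Abelian.Ext A B j) :
    z.comp (Abelian.Ext.mk₀ (x • 𝟙 B)) (add_zero j) = x • z := by
  rw [Abelian.Ext.mk₀_smul, Abelian.Ext.comp_smul, Abelian.Ext.comp_mk₀_id]

/-- Nakayama step. -/
lemma EV.nak [IsLocalRing R] [IsNoetherianRing R] [Module.Finite R X] [Module.Finite R T]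
    {x : R} (hx : x ∈ maximalIdeal R) (reg : IsSMulRegular X x) {j : ℕ}
    (h : EV R (QuotSMulTop x X) T (j + 1)) : EV R X T j := by
  have hs := IsSMulRegular.smulShortComplex_shortExact (M := ModuleCat.of R X) reg
  let E := Abelian.Ext (ModuleCat.of R X) (ModuleCat.of R T) j
  have key : (⊤ : Submodule R E) ≤ maximalIdeal R • (⊤ : Submodule R E) := by
    intro y _
    obtain ⟨z, hz⟩ := Abelian.Ext.contravariant_sequence_exact₁ hs _ y (add_comm 1 j) (h _)
    have : y = x • z := hz.symm.trans (mk_comp x z)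
    rw [this]
    exact Submodule.smul_mem_smul hx trivial
  have : (⊤ : Submodule R E) = ⊥ :=
    Submodule.eq_bot_of_le_smul_of_le_jacobson_bot _ _ Module.Finite.fg_top key
      (maximalIdeal_le_jacobson _)
  intro y
  exact (Submodule.mem_bot R).1 (this ▸ (trivial : y ∈ (⊤ : Submodule R E)))

/-- Depth inductive step. -/
lemma EV.reg_step [IsLocalRing R]
    {x : R} (hx : x ∈ maximalIdeal R) (reg : IsSMulRegular X x) {j : ℕ}
    (h : ∀ i < j, EV R (ResidueField R) (QuotSMulTop x X) i) :
    ∀ i < j + 1, EV R (ResidueField R) X i := by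
  have hs := IsSMulRegular.smulShortComplex_shortExact (M := ModuleCat.of R X) reg
  have ann : ∀ r : ResidueField R, x • r = 0 := fun r => by
    rw [Algebra.smul_def, IsLocalRing.ResidueField.algebraMap_eq, (residue_eq_zero_iff x).2 hx,
      zero_mul]
  intro i hi
  rcases i with _ | i
  · rw [EV.zero_iff]
    exact IsSMulRegular.linearMap_subsingleton_of_mem_annihilator reg (Module.mem_annihilator.2 ann)
  · intro y
    obtain ⟨z, rfl⟩ := Abelian.Ext.covariant_sequence_exact₁ _ hs y (by
      refine (comp_mk x y).trans ?_
      have h0 : x • 𝟙 (ModuleCat.of R (ResidueField R)) = 0 := by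
        ext r
        exact ann r
      have : x • y = (Abelian.Ext.mk₀ (x • 𝟙 (ModuleCat.of R (ResidueField R)))).comp y
          (zero_add _) := (mk_comp x y).symm
      rw [this, h0]; simp; rfl) rfl
    have : z = 0 := h i (by omega) z
    rw [this, Abelian.Ext.zero_comp]
    rfl

lemma EV.of_wreg [IsLocalRing R] (rs : List R) (hrs : ∀ r ∈ rs, r ∈ maximalIdeal R)
    (X : Type) [AddCommGroup X] [Module R X]
    (h : IsWeaklyRegular X rs) : ∀ i < rs.length, EV R (ResidueField R) X i := by
  induction rs generalizing X with
  | nil => simp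
  | cons x rs ih =>
    rw [isWeaklyRegular_cons_iff] at h
    exact EV.reg_step (hrs x (by simp)) h.1 (ih (fun r hr => hrs r (by simp [hr])) _ h.2)

lemma EV.cof_wreg [IsLocalRing R] [IsNoetherianRing R] [Module.Finite R T] (n : ℕ)
    (hT : ∀ (X : Type) [AddCommGroup X] [Module R X] [Module.Finite R X] (i : ℕ), n < i → EV R X T i)
    (rs : List R) (hrs : ∀ r ∈ rs, r ∈ maximalIdeal R)
    (X : Type) [AddCommGroup X] [Module R X] [Module.Finite R X]
    (h : IsWeaklyRegular X rs) : ∀ i, n < i + rs.length → EV R X T i := by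
  induction rs generalizing X with
  | nil => exact hT X
  | cons x rs ih =>
    rw [isWeaklyRegular_cons_iff] at h
    intro i hi
    refine EV.nak (hrs x (by simp)) h.1 (ih (fun r hr => hrs r (by simp [hr])) _ h.2 (i + 1) ?_)
    simp at hi
    omega

lemma exists_reg [IsLocalRing R] [IsNoetherianRing R] (t : ℕ)
    (X : Type) [AddCommGroup X] [Module R X] [Module.Finite R X] [Nontrivial X]
    (h : ∀ i < t, EV R (ResidueField R) X i) :
    ∃ rs : List R, rs.length = t ∧ (∀ r ∈ rs, r ∈ maximalIdeal R) ∧ IsRegular X rs := by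
  induction t generalizing X with
  | zero => exact ⟨[], rfl, by simp, IsRegular.nil R X⟩
  | succ t ih =>
    have h0 := EV.zero_iff.1 (h 0 (by omega))
    obtain ⟨x, hx, reg⟩ := IsSMulRegular.subsingleton_linearMap_iff.1 h0
    have hxm : x ∈ maximalIdeal R := by
      rw [← residue_eq_zero_iff]
      have := Module.mem_annihilator.1 hx 1
      rwa [Algebra.smul_def, mul_one] at this
    have : Nontrivial (QuotSMulTop x X) := by
      have := Submodule.Quotient.nontrivial_iff.2
        (Submodule.top_ne_pointwise_smul_of_mem_jacobson_annihilator
        (R := R) (M := X) (maximalIdeal_le_jacobson _ hxm)).symm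
      exact this
    have hs := IsSMulRegular.smulShortComplex_shortExact (M := ModuleCat.of R X) reg
    obtain ⟨rs, hl, hm, hr⟩ := ih (QuotSMulTop x X) (fun i hi => by
      intro y
      obtain ⟨z, rfl⟩ := Abelian.Ext.covariant_sequence_exact₃ _ hs y rfl
        (h (i + 1) (by omega) _)
      have : z = 0 := h i (by omega) z
      rw [this, Abelian.Ext.zero_comp]
      rfl)
    exact ⟨x :: rs, by simp [hl], List.forall_mem_cons.2 ⟨hxm, hm⟩, (isRegular_cons_iff _ _ _).2 ⟨reg, hr⟩⟩

lemma le_depth_iff [IsLocalRing R] [IsNoetherianRing R] (t : ℕ)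
    (X : Type) [AddCommGroup X] [Module R X] [Module.Finite R X] [Nontrivial X] :
    (t : ℕ∞) ≤ moduleDepth R X ↔ ∀ i < t, EV R (ResidueField R) X i := by
  constructor
  · intro h i hi
    have : (i : ℕ∞) < moduleDepth R X := lt_of_lt_of_le (by exact_mod_cast hi) h
    obtain ⟨a, ⟨rs, rfl, hrs, hreg⟩, ha⟩ := lt_sSup_iff.1 this
    exact EV.of_wreg rs hrs X hreg.toIsWeaklyRegular i (by exact_mod_cast ha)
  · intro h
    obtain ⟨rs, hl, hm, hr⟩ := exists_reg t X h
    exact le_sSup ⟨rs, by rw [hl], hm, hr⟩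

lemma depth_le_dim [IsLocalRing R] [IsNoetherianRing R] (t : ℕ)
    (X : Type) [AddCommGroup X] [Module R X] [Module.Finite R X]
    (h : moduleDim R X = t) : moduleDepth R X ≤ t := by
  refine sSup_le ?_
  rintro _ ⟨rs, rfl, hrs, hreg⟩
  have := Module.supportDim_add_length_eq_supportDim_of_isRegular rs hreg
  have h' : Module.supportDim R X = t := h
  rw [h'] at this
  have nt : Nontrivial (X ⧸ (Ideal.ofList rs • (⊤ : Submodule R X))) :=
    Submodule.Quotient.nontrivial_iff.2 hreg.top_ne_smul.symm
  have h0 := Module.supportDim_ne_bot_of_nontrivial R (X ⧸ (Ideal.ofList rs • (⊤ : Submodule R X)))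
  generalize Module.supportDim R (X ⧸ (Ideal.ofList rs • (⊤ : Submodule R X))) = u at this h0
  cases u using WithBot.recBotCoe with
  | bot => exact absurd rfl h0
  | coe u =>
    have e : u + (rs.length : ℕ∞) = (t : ℕ∞) := by exact_mod_cast this
    rw [← e]
    exact le_add_self

lemma ann_quot (x : R) : Module.annihilator R X ⊔ Ideal.span {x} ≤
    Module.annihilator R (QuotSMulTop x X) := by
  refine sup_le ?_ ?_
  · exact LinearMap.annihilator_le_of_surjective
      (Submodule.mkQ (x • (⊤ : Submodule R X))) (Submodule.mkQ_surjective _)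
  · rw [Ideal.span_singleton_le_iff_mem, Module.mem_annihilator]
    intro m
    obtain ⟨m, rfl⟩ := Submodule.mkQ_surjective _ m
    rw [← map_smul]
    exact (Submodule.Quotient.mk_eq_zero _).2 (Submodule.smul_mem_pointwise_smul _ _ _ trivial)

lemma EV.cof_dim_aux [IsNoetherianRing R] (Φ : ℕ → WithBot ℕ∞ → Prop)
    (hanti : ∀ i δ δ', δ' ≤ δ → Φ i δ → Φ i δ') (J : Ideal R)
    (hp : ∀ p : Ideal R, p.IsPrime → J ≤ p → ∀ i, Φ i (Module.supportDim R (R ⧸ p)) →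
      EV R (R ⧸ p) T i)
    (X : Type) [AddCommGroup X] [Module R X] [hX : Module.Finite R X] :
    J ≤ Module.annihilator R X → ∀ i, Φ i (Module.supportDim R X) → EV R X T i := by
  induction hX using IsNoetherianRing.induction_on_isQuotientEquivQuotientPrime R with
  | subsingleton N => intro _ i _; exact EV.of_csubsingleton i
  | quotient N p f =>
    intro hJ i hi
    refine EV.ccongr f.symm (hp p.1 p.2 ?_ i ?_)
    · rwa [f.annihilator_eq, Ideal.annihilator_quotient] at hJ
    · rwa [Module.supportDim_eq_of_equiv f] at hi
  | exact N₁ N₂ N₃ f g hf hg hfg h₁ h₃ =>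
    intro hJ i hi
    refine EV.cmid hf hg hfg (h₁ ?_ i ?_) (h₃ ?_ i ?_)
    · exact hJ.trans (LinearMap.annihilator_le_of_injective f hf)
    · exact hanti _ _ _ (Module.supportDim_le_of_injective f hf) hi
    · exact hJ.trans (LinearMap.annihilator_le_of_surjective g hg)
    · exact hanti _ _ _ (Module.supportDim_le_of_surjective g hg) hi

lemma EV.cof_dim [IsLocalRing R] [IsNoetherianRing R] [Module.Finite R T]
    (Φ : ℕ → WithBot ℕ∞ → Prop)
    (hanti : ∀ i δ δ', δ' ≤ δ → Φ i δ → Φ i δ')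
    (hstep : ∀ i δ δ', δ' + 1 ≤ δ → Φ i δ → Φ (i + 1) δ')
    (hk : ∀ i, Φ i 0 → EV R (ResidueField R) T i)
    (X : Type) [AddCommGroup X] [Module R X] [Module.Finite R X] (i : ℕ)
    (hi : Φ i (Module.supportDim R X)) : EV R X T i := by
  refine EV.cof_dim_aux Φ hanti ⊥ ?_ X bot_le i hi
  intro p hp _
  induction p using WellFoundedGT.induction with
  | ind p ih =>
  intro i hi
  by_cases hpm : p = maximalIdeal R
  · subst hpm
    refine hk i (hanti _ _ _ ?_ hi)
    have h0 := Module.supportDim_ne_bot_of_nontrivial R (R ⧸ maximalIdeal R)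
    generalize Module.supportDim R (R ⧸ maximalIdeal R) = u at h0
    cases u using WithBot.recBotCoe with
    | bot => exact absurd rfl h0
    | coe u => exact_mod_cast (zero_le (a := u))
  · have hle := IsLocalRing.le_maximalIdeal hp.ne_top
    obtain ⟨x, hxm, hxp⟩ := SetLike.exists_of_lt (lt_of_le_of_ne hle hpm)
    have reg : IsSMulRegular (R ⧸ p) x := by
      intro a b hab
      have : (Ideal.Quotient.mk p x) * a = (Ideal.Quotient.mk p x) * b := hab
      exact mul_left_cancel₀ (by rwa [Ne, Ideal.Quotient.eq_zero_iff_mem]) this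
    refine EV.nak hxm reg ?_
    refine EV.cof_dim_aux Φ hanti (p ⊔ Ideal.span {x}) ?_ _ ?_ _ ?_
    · intro q hq hpq
      have hlt : p < q := lt_of_le_of_ne (le_sup_left.trans hpq) (by
        rintro rfl
        exact hxp (hpq (Ideal.mem_sup_right (Ideal.mem_span_singleton_self x))))
      exact ih q hlt hq bot_le
    · refine le_trans (sup_le_sup_right ?_ _) (ann_quot x (X := R ⧸ p))
      rw [Ideal.annihilator_quotient]
    · exact hstep _ _ _ (Module.supportDim_quotSMulTop_succ_eq_supportDim reg hxm).le hi

/-- Weak regularity passes to `Hom(P, -)`, for projective `P`. -/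
lemma wreg_hom (P : Type) [AddCommGroup P] [Module R P] [Module.Projective R P] (rs : List R)
    (N : Type) [AddCommGroup N] [Module R N] (h : IsWeaklyRegular N rs) :
    IsWeaklyRegular (P →ₗ[R] N) rs := by
  induction rs generalizing N with
  | nil => exact IsWeaklyRegular.nil R _
  | cons x rs ih =>
    rw [isWeaklyRegular_cons_iff] at h ⊢
    refine ⟨?_, ?_⟩
    · intro f g hfg
      ext p
      exact h.1 (LinearMap.congr_fun hfg p)
    · have h2 := ih _ h.2
      let q : N →ₗ[R] QuotSMulTop x N := Submodule.mkQ _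
      have hq : Function.Surjective q := Submodule.mkQ_surjective _
      let φ : (P →ₗ[R] N) →ₗ[R] (P →ₗ[R] QuotSMulTop x N) := LinearMap.compRight R q
      have hφ : Function.Surjective φ := fun f => by
        obtain ⟨g, hg⟩ := Module.projective_lifting_property q f hq
        exact ⟨g, hg⟩
      have hker : LinearMap.ker φ = x • (⊤ : Submodule R (P →ₗ[R] N)) := by
        ext f
        constructor
        · intro hf
          have hf' : ∀ p, f p ∈ LinearMap.range (LinearMap.lsmul R N x) := fun p => by
            have h1 : q (f p) = 0 := LinearMap.congr_fun hf p
            have := (Submodule.Quotient.mk_eq_zero _).1 h1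
            obtain ⟨y, _, hy⟩ := this
            exact ⟨y, hy⟩
          obtain ⟨g, hg⟩ := Module.projective_lifting_property
            (LinearMap.rangeRestrict (LinearMap.lsmul R N x))
            (f.codRestrict _ hf') (LinearMap.surjective_rangeRestrict _)
          have : f = x • g := by
            ext p
            exact (congrArg Subtype.val (LinearMap.congr_fun hg p)).symm
          rw [this]
          exact Submodule.smul_mem_pointwise_smul _ _ _ trivial
        · rintro ⟨g, _, rfl⟩
          rw [LinearMap.mem_ker]
          ext p
          exact (Submodule.Quotient.mk_eq_zero _).2
            (Submodule.smul_mem_pointwise_smul (g p) x _ trivial)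
      let e : QuotSMulTop x (P →ₗ[R] N) ≃ₗ[R] (P →ₗ[R] QuotSMulTop x N) :=
        (Submodule.quotEquivOfEq _ _ hker.symm).trans (φ.quotKerEquivOfSurjective hφ)
      exact (LinearEquiv.isWeaklyRegular_congr e rs).2 h2

section cplx

variable {G : ℕ → Type} [∀ i, AddCommGroup (G i)] [∀ i, Module R (G i)]
  (δ : ∀ i, G i →ₗ[R] G (i + 1)) (B : ∀ i, Submodule R (G i))

lemma seqG_right (hBs : ∀ i, B (i + 1) = LinearMap.range (δ i)) (i j : ℕ)
    (h2 : EV R T (G i) j) (h1 : EV R T (LinearMap.ker (δ i)) (j + 1)) : EV R T (B (i + 1)) j := by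
  rw [hBs]
  refine EV.right (f := (LinearMap.ker (δ i)).subtype) (g := (δ i).rangeRestrict)
    (Submodule.injective_subtype _) (LinearMap.surjective_rangeRestrict _) ?_ h2 h1
  rw [LinearMap.exact_iff]; simp

lemma seqG_left (hBs : ∀ i, B (i + 1) = LinearMap.range (δ i)) (i j : ℕ)
    (h3 : EV R T (B (i + 1)) j) (h2 : EV R T (G i) (j + 1)) :
    EV R T (LinearMap.ker (δ i)) (j + 1) := by
  rw [hBs] at h3
  refine EV.left (f := (LinearMap.ker (δ i)).subtype) (g := (δ i).rangeRestrict)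
    (Submodule.injective_subtype _) (LinearMap.surjective_rangeRestrict _) ?_ h3 h2
  rw [LinearMap.exact_iff]; simp

lemma B_low (hB0 : B 0 = ⊥) (hBs : ∀ i, B (i + 1) = LinearMap.range (δ i)) (n c : ℕ)
    (hG : ∀ i, ∀ j < n, EV R T (G i) j)
    (hlow : ∀ i < c, B i = LinearMap.ker (δ i)) :
    ∀ i ≤ c, ∀ j, j + i ≤ n → EV R T (B i) j := by
  intro i
  induction i with
  | zero =>
    intro _ j _
    rw [hB0]
    exact EV.of_subsingleton j
  | succ i ih =>
    intro hi j hj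
    refine seqG_right δ B hBs i j (hG i j (by omega)) ?_
    rw [← hlow i (by omega)]
    exact ih (by omega) _ (by omega)

lemma Z_high (hBs : ∀ i, B (i + 1) = LinearMap.range (δ i)) (n c : ℕ)
    (hG : ∀ i, ∀ j < n, EV R T (G i) j)
    (hhigh : ∀ i, c + 1 < i → B i = LinearMap.ker (δ i)) :
    ∀ j < n, ∀ i, c + 1 ≤ i → EV R T (LinearMap.ker (δ i)) j := by
  intro j
  induction j with
  | zero =>
    intro hj i _
    exact EV.left_zero (Submodule.injective_subtype _) (hG i 0 hj)
  | succ j ih =>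
    intro hj i hi
    refine seqG_left δ B hBs i j ?_ (hG i _ hj)
    rw [hhigh (i + 1) (by omega)]
    exact ih (by omega) _ (by omega)

variable {K D : Type} [AddCommGroup K] [Module R K] [AddCommGroup D] [Module R D]

lemma exact_of_ker {N : Type} [AddCommGroup N] [Module R N] {A C : Submodule R N} (hAC : A ≤ C)
    (q : C →ₗ[R] K) (hk : LinearMap.ker q = A.comap C.subtype) :
    Function.Exact (Submodule.inclusion hAC) q := by
  rw [LinearMap.exact_iff, hk, Submodule.range_inclusion]

lemma main_complex (hB0 : B 0 = ⊥) (hBs : ∀ i, B (i + 1) = LinearMap.range (δ i))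
    (hBZ : ∀ i, B i ≤ LinearMap.ker (δ i)) (n d : ℕ) (hdn : d ≤ n)
    (hG : ∀ i, ∀ j < n, EV R T (G i) j)
    (hlow : ∀ i < n - d, B i = LinearMap.ker (δ i))
    (hhigh : ∀ i, n - d + 1 < i → B i = LinearMap.ker (δ i))
    (qK : LinearMap.ker (δ (n - d)) →ₗ[R] K) (hqK : Function.Surjective qK)
    (hkK : LinearMap.ker qK = (B (n - d)).comap (LinearMap.ker (δ (n - d))).subtype)
    (qD : LinearMap.ker (δ (n - d + 1)) →ₗ[R] D) (hqD : Function.Surjective qD)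
    (hkD : LinearMap.ker qD = (B (n - d + 1)).comap (LinearMap.ker (δ (n - d + 1))).subtype)
    (b : ℕ) (hb : b + 2 ≤ d) :
    ((∀ i < b, EV R T D i) → ∀ i < b + 2, EV R T K i) ∧ (EV R T K (b + 2) → EV R T D b) := by
  have hlo := B_low δ B hB0 hBs n (n - d) hG hlow (n - d) le_rfl
  have hhi := fun j hj => Z_high δ B hBs n (n - d) hG hhigh j hj (n - d + 1) le_rfl
  have iK := Submodule.inclusion_injective (hBZ (n - d))
  have iD := Submodule.inclusion_injective (hBZ (n - d + 1))
  have eK := exact_of_ker (hBZ (n - d)) qK hkK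
  have eD := exact_of_ker (hBZ (n - d + 1)) qD hkD
  constructor
  · intro hD
    have h1 : ∀ i < b + 1, EV R T (B (n - d + 1)) i := by
      rintro (_ | i) hi
      · exact EV.left_zero (Submodule.injective_subtype _) (hG _ 0 (by omega))
      · exact EV.left iD hqD eD (hD i (by omega)) (hhi _ (by omega))
    have h2 : ∀ i < b + 2, EV R T (LinearMap.ker (δ (n - d))) i := by
      rintro (_ | i) hi
      · exact EV.left_zero (Submodule.injective_subtype _) (hG _ 0 (by omega))
      · exact seqG_left δ B hBs _ i (h1 i (by omega)) (hG _ _ (by omega))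
    intro i hi
    exact EV.right iK hqK eK (h2 i hi) (hlo _ (by omega))
  · intro hK
    have h2 := EV.mid iK hqK eK (hlo (b + 2) (by omega)) hK
    have h1 := seqG_right δ B hBs _ (b + 1) (hG _ _ (by omega)) h2
    exact EV.right iD hqD eD (hhi b (by omega)) h1

end cplx

section bridge
variable {M : Type} (N : Type) [AddCommGroup M] [Module R M] [AddCommGroup N] [Module R N]
variable (P : ProjectiveResolution (ModuleCat.of R M))

abbrev Cx : CochainComplex (ModuleCat.{0} R) ℕ :=
  P.complex.linearYonedaObj R (ModuleCat.of R N)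

abbrev GG (i : ℕ) : Type := P.complex.X i ⟶ ModuleCat.of R N

abbrev dd (i : ℕ) : GG N P i →ₗ[R] GG N P (i + 1) :=
  Linear.leftComp R _ (P.complex.d (i + 1) i)

def BB : ∀ i, Submodule R (GG N P i)
  | 0 => ⊥
  | i + 1 => LinearMap.range (dd N P i)

lemma BB_le (i : ℕ) : BB N P i ≤ LinearMap.ker (dd N P i) := by
  cases i with
  | zero => exact bot_le
  | succ i =>
    rintro _ ⟨g, rfl⟩
    change P.complex.d _ _ ≫ P.complex.d _ _ ≫ g = 0
    rw [← Category.assoc, P.complex.d_comp_d, Limits.zero_comp]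

lemma Cx_d (i j : ℕ) : ((Cx N P).d i j).hom = Linear.leftComp R _ (P.complex.d j i) := rfl

lemma homology_surj (S : ShortComplex (ModuleCat.{0} R)) :
    ∃ q : LinearMap.ker S.g.hom →ₗ[R] S.homology, Function.Surjective q ∧
      LinearMap.ker q = (LinearMap.range S.f.hom).comap (LinearMap.ker S.g.hom).subtype := by
  let e : (LinearMap.ker S.g.hom ⧸ LinearMap.range S.moduleCatToCycles) ≃ₗ[R] S.homology :=
    S.moduleCatHomologyIso.toLinearEquiv.symm
  refine ⟨e.toLinearMap.comp (Submodule.mkQ _), e.surjective.comp (Submodule.mkQ_surjective _), ?_⟩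
  rw [LinearEquiv.ker_comp, Submodule.ker_mkQ]
  ext x
  constructor
  · rintro ⟨y, rfl⟩
    exact ⟨y, rfl⟩
  · rintro ⟨y, hy⟩
    exact ⟨y, Subtype.ext hy⟩

lemma ext_surj (i : ℕ) :
    ∃ q : LinearMap.ker (dd N P i) →ₗ[R] extModule R i M N, Function.Surjective q ∧
      LinearMap.ker q = (BB N P i).comap (LinearMap.ker (dd N P i)).subtype := by
  obtain ⟨p, hp, hB⟩ : ∃ p, (ComplexShape.up ℕ).prev i = p ∧
      LinearMap.range ((Cx N P).d p i).hom = BB N P i := by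
    cases i with
    | zero =>
      refine ⟨0, CochainComplex.prev_nat_zero, ?_⟩
      rw [(Cx N P).shape 0 0 (by simp)]
      exact LinearMap.range_zero
    | succ i => exact ⟨i, by simp, rfl⟩
  obtain ⟨q, hq, hk⟩ := homology_surj ((Cx N P).sc' p i (i + 1))
  let e : extModule R i M N ≃ₗ[R] ((Cx N P).sc' p i (i + 1)).homology :=
    (P.isoExt i (ModuleCat.of R N) ≪≫
      (Cx N P).homologyIsoSc' p i (i + 1) hp (by simp)).toLinearEquiv
  refine ⟨e.symm.toLinearMap.comp q, e.symm.surjective.comp hq, ?_⟩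
  refine (LinearEquiv.ker_comp e.symm q).trans (hk.trans ?_)
  rw [← hB]
  rfl

lemma extMk_zero_iff (f : P.complex.X 0 ⟶ ModuleCat.of R N) (hf : P.complex.d 1 0 ≫ f = 0) :
    P.extMk f 1 rfl hf = 0 ↔ f = 0 := by
  simp only [← P.extEquivCohomologyClass.apply_eq_iff_eq,
    ProjectiveResolution.extEquivCohomologyClass_extMk,
    ProjectiveResolution.extEquivCohomologyClass_zero,
    CochainComplex.HomComplex.CohomologyClass.mk_eq_zero_iff]
  rw [CochainComplex.HomComplex.Cocycle.toSingleMk_mem_coboundaries_iff _ _ _ _ _ 1 (by simp)]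
  constructor
  · rintro ⟨g, hg⟩
    have hz : P.cochainComplex.d (-(0 : ℕ)) 1 = 0 :=
      (CochainComplex.isZero_of_isStrictlyLE _ 0 _).eq_of_tgt _ _
    rw [← cancel_epi (P.cochainComplexXIso (-(0 : ℕ)) 0 rfl).hom, ← hg, hz]
    simp
  · rintro rfl
    exact ⟨0, by simp⟩

lemma smul_extMk {n : ℕ} (r : R) (f : P.complex.X n ⟶ ModuleCat.of R N)
    (hf : P.complex.d (n + 1) n ≫ f = 0) (hf' : P.complex.d (n + 1) n ≫ (r • f) = 0) :
    P.extMk (r • f) (n + 1) rfl hf' = r • P.extMk f (n + 1) rfl hf := by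
  rw [← comp_mk, ProjectiveResolution.extMk_comp_mk₀]
  congr 1

lemma abext_surj (i : ℕ) :
    ∃ q : LinearMap.ker (dd N P i) →ₗ[R] Abelian.Ext (ModuleCat.of R M) (ModuleCat.of R N) i,
      Function.Surjective q ∧
      LinearMap.ker q = (BB N P i).comap (LinearMap.ker (dd N P i)).subtype := by
  let q : LinearMap.ker (dd N P i) →ₗ[R] Abelian.Ext (ModuleCat.of R M) (ModuleCat.of R N) i :=
    { toFun := fun f => P.extMk f.1 (i + 1) rfl f.2
      map_add' := fun f g => (ProjectiveResolution.add_extMk _ _ _ _ _ _ _).symm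
      map_smul' := fun r f => smul_extMk N P r f.1 f.2 _ }
  refine ⟨q, ?_, ?_⟩
  · intro α
    obtain ⟨f, hf, h⟩ := P.extMk_surjective α (i + 1) rfl
    exact ⟨⟨f, hf⟩, h⟩
  · ext f
    cases i with
    | zero => exact extMk_zero_iff N P f.1 f.2
    | succ i => exact P.extMk_eq_zero_iff f.1 _ rfl f.2 i rfl

lemma ext_equiv (M N : Type) [AddCommGroup M] [Module R M] [AddCommGroup N] [Module R N] (i : ℕ) :
    Nonempty (extModule R i M N ≃ₗ[R] Abelian.Ext (ModuleCat.of R M) (ModuleCat.of R N) i) := by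
  let P := projectiveResolution (ModuleCat.of R M)
  obtain ⟨q, hq, hk⟩ := ext_surj N P i
  obtain ⟨q', hq', hk'⟩ := abext_surj N P i
  exact ⟨((q.quotKerEquivOfSurjective hq).symm.trans
    (Submodule.quotEquivOfEq _ _ (hk.trans hk'.symm))).trans (q'.quotKerEquivOfSurjective hq')⟩

lemma EV_iff (M N : Type) [AddCommGroup M] [Module R M] [AddCommGroup N] [Module R N] (i : ℕ) :
    EV R M N i ↔ Subsingleton (extModule R i M N) := by
  obtain ⟨e⟩ := ext_equiv (R := R) M N i
  constructor
  · intro h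
    exact ⟨fun a b => e.injective ((h _).trans (h _).symm)⟩
  · intro h x
    exact e.symm.injective (Subsingleton.elim _ _)

lemma BB_eq_of_EV (i : ℕ) (h : EV R M N i) : BB N P i = LinearMap.ker (dd N P i) := by
  obtain ⟨q, hq, hk⟩ := ext_surj N P i
  have := (EV_iff M N i).1 h
  refine le_antisymm (BB_le N P i) fun f hf => ?_
  have : (⟨f, hf⟩ : LinearMap.ker (dd N P i)) ∈ LinearMap.ker q := Subsingleton.elim _ _
  rw [hk] at this
  exact this

end bridge

lemma finite_extModule [IsNoetherianRing R] (M N : Type) [AddCommGroup M] [Module R M]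
    [AddCommGroup N] [Module R N] [Module.Finite R M] [Module.Finite R N] (i : ℕ) :
    Module.Finite R (extModule R i M N) := by
  obtain ⟨e⟩ := ext_equiv (R := R) M N i
  exact Module.Finite.equiv e.symm

lemma EV_GG [IsLocalRing R] [IsNoetherianRing R] (n : ℕ)
    (hk : ∀ i < n, EV R (ResidueField R) R i)
    (M : Type) [AddCommGroup M] [Module R M] (P : ProjectiveResolution (ModuleCat.of R M)) (i : ℕ) :
    ∀ j < n, EV R (ResidueField R) (GG R P i) j := by
  intro j hj
  obtain ⟨rs, hl, hm, hr⟩ := exists_reg n R hk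
  haveI : Projective (P.complex.X i) := P.projective i
  have := wreg_hom (P.complex.X i) rs R hr.toIsWeaklyRegular
  have h := EV.of_wreg rs hm _ this j (by omega)
  exact EV.congr ((ModuleCat.homLinearEquiv (S := R) (M := P.complex.X i) (N := ModuleCat.of R R)).symm) h

lemma gor_high [IsLocalRing R] [IsNoetherianRing R] (n : ℕ)
    (hk : ∀ i, i ≠ n → EV R (ResidueField R) R i)
    (X : Type) [AddCommGroup X] [Module R X] [Module.Finite R X] (i : ℕ) (hi : n < i) :
    EV R X R i :=
  EV.cof_dim (fun i _ => n < i) (fun _ _ _ _ h => h) (fun _ _ _ _ h => Nat.lt_succ_of_lt h)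
    (fun i h => hk i (by omega)) X i hi

lemma gor_low [IsLocalRing R] [IsNoetherianRing R] (n : ℕ)
    (hk : ∀ i, i ≠ n → EV R (ResidueField R) R i)
    (X : Type) [AddCommGroup X] [Module R X] [Module.Finite R X] (d : ℕ)
    (hd : Module.supportDim R X = d) (i : ℕ) (hi : d + i < n) :
    EV R X R i := by
  refine EV.cof_dim (fun i δ => δ + i < n) ?_ ?_ ?_ X i ?_
  · intro i δ δ' h h'
    exact lt_of_le_of_lt (by gcongr) h'
  · intro i δ δ' h h'
    refine lt_of_le_of_lt ?_ h'
    calc δ' + ((i + 1 : ℕ) : WithBot ℕ∞) = (δ' + 1) + i := by push_cast; ring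
      _ ≤ δ + i := by gcongr
  · intro i h
    refine hk i ?_
    rintro rfl
    simp at h
  · rw [hd]; exact_mod_cast hi

lemma supportDim_change {R A M : Type} [CommRing R] [CommRing A] [Algebra R A]
    (hs : Function.Surjective (algebraMap R A)) [AddCommGroup M] [Module A M] [Module R M]
    [IsScalarTower R A M] [Module.Finite A M] [Module.Finite R M] :
    Module.supportDim R M = Module.supportDim A M := by
  rw [Module.supportDim_eq_ringKrullDim_quotient_annihilator,
    Module.supportDim_eq_ringKrullDim_quotient_annihilator]
  have hc : Module.annihilator R M = (Module.annihilator A M).comap (algebraMap R A) := by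
    ext r
    simp [Module.mem_annihilator, Ideal.mem_comap]
  let f : R →+* A ⧸ Module.annihilator A M := (Ideal.Quotient.mk _).comp (algebraMap R A)
  have hf : Function.Surjective f := Ideal.Quotient.mk_surjective.comp hs
  have hker : RingHom.ker f = Module.annihilator R M := by
    rw [hc]; ext r; exact Ideal.Quotient.eq_zero_iff_mem
  exact ringKrullDim_eq_of_ringEquiv
    ((Ideal.quotEquivOfEq hker.symm).trans (RingHom.quotientKerEquivOfSurjective hf))

lemma exists_lift_wreg {R A M : Type} [CommRing R] [CommRing A] [IsLocalRing R] [IsLocalRing A]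
    [Algebra R A] (hs : Function.Surjective (algebraMap R A)) [AddCommGroup M] [Module A M]
    [Module R M] [IsScalarTower R A M] (t : ℕ) (h : moduleDepth A M = (t : ℕ)) (ht : 1 ≤ t) :
    ∃ rs : List R, t ≤ rs.length ∧ (∀ r ∈ rs, r ∈ maximalIdeal R) ∧ IsWeaklyRegular M rs := by
  have h1 : ((t - 1 : ℕ) : ℕ∞) < moduleDepth A M := by
    rw [h]; exact_mod_cast (by omega)
  obtain ⟨a, ⟨rs, rfl, hrs, hreg⟩, ha⟩ := lt_sSup_iff.1 h1
  obtain ⟨rs', rfl⟩ := (List.map_surjective_iff.2 hs) rs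
  refine ⟨rs', ?_, ?_, (isWeaklyRegular_map_algebraMap_iff A M rs').1 hreg.toIsWeaklyRegular⟩
  · have : t - 1 < rs'.length := by rw [List.length_map] at ha; exact_mod_cast ha
    omega
  · intro r hr
    have := hrs (algebraMap R A r) (List.mem_map_of_mem hr)
    rw [mem_maximalIdeal, mem_nonunits_iff] at this ⊢
    exact fun hu => this (hu.map _)

lemma final [IsLocalRing R] [IsNoetherianRing R] (d : ℕ) (hd2 : 2 ≤ d)
    (D K : Type) [AddCommGroup D] [Module R D] [AddCommGroup K] [Module R K]
    [Module.Finite R D] [Module.Finite R K]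
    (hdim : moduleDim R D = ((d - 2 : ℕ) : WithBot ℕ∞))
    (h : ∀ b, b + 2 ≤ d → ((∀ i < b, EV R (ResidueField R) D i) →
      ∀ i < b + 2, EV R (ResidueField R) K i) ∧
      (EV R (ResidueField R) K (b + 2) → EV R (ResidueField R) D b)) :
    moduleDepth R D = moduleDepth R K - 2 := by
  have hle := depth_le_dim (d - 2) D hdim
  haveI : Nontrivial D := by
    rw [← Module.supportDim_ne_bot_iff_nontrivial R]
    intro hb
    have : Module.supportDim R D = ((d - 2 : ℕ) : WithBot ℕ∞) := hdim
    rw [hb] at this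
    exact absurd this.symm (WithBot.natCast_ne_bot _)
  obtain ⟨b, hb⟩ := ENat.ne_top_iff_exists.1 (ne_top_of_le_ne_top (ENat.coe_ne_top _) hle)
  have hb2 : b + 2 ≤ d := by
    rw [← hb] at hle
    have : b ≤ d - 2 := by exact_mod_cast hle
    omega
  have hDlow := (le_depth_iff b D).1 hb.le
  have hDb : ¬ EV R (ResidueField R) D b := fun hE => by
    have := (le_depth_iff (b + 1) D).2 fun i hi => by
      rcases Nat.lt_succ_iff_lt_or_eq.1 hi with h | rfl
      · exact hDlow i h
      · exact hE
    rw [← hb] at this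
    have : b + 1 ≤ b := by exact_mod_cast this
    omega
  have hK := (h b hb2).1 hDlow
  have hKb : ¬ EV R (ResidueField R) K (b + 2) := fun hE => hDb ((h b hb2).2 hE)
  haveI : Nontrivial K := by
    by_contra hn
    rw [not_nontrivial_iff_subsingleton] at hn
    exact hKb (EV.of_subsingleton _)
  have h1 := (le_depth_iff (b + 2) K).2 hK
  have h2 : ¬ ((b + 3 : ℕ) : ℕ∞) ≤ moduleDepth R K := fun hh =>
    hKb ((le_depth_iff (b + 3) K).1 hh (b + 2) (by omega))
  have h3 : moduleDepth R K = ((b + 2 : ℕ) : ℕ∞) := by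
    refine le_antisymm ?_ h1
    rw [not_le] at h2
    exact Order.le_of_lt_succ (by
      rw [ENat.succ_def]
      exact_mod_cast h2)
  rw [← hb, h3]
  norm_cast

end Aux

/-- if `dim M = d ≥ 2`, `depth M = d-1` and `dim D^{d-1}(M) = d-2`, then
`depth D^{d-1}(M) = depth K_M - 2`, where `K_M = D^d(M)` and `D^i(M) = Ext_R^{n-i}(M,R)`. -/
theorem stmt_1
    (R : Type) [CommRing R] [IsLocalRing R] (hGor : IsGorensteinLocalRing R)
    (n : ℕ) (hn : ringKrullDim R = n)
    (A : Type) [CommRing A] [IsLocalRing A] [IsNoetherianRing A]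
    (π : R →+* A) (hπ : Function.Surjective π)
    (M : Type) [AddCommGroup M] [Module A M] [Module R M] [Module.Finite A M]
    (hcompat : ∀ (r : R) (m : M), π r • m = r • m)
    (d : ℕ) (hd : moduleDim A M = d) (hd2 : 2 ≤ d)
    (hdepth : moduleDepth A M = (d - 1 : ℕ))
    (hdimD : moduleDim R ↥(extModule R (n - (d - 1)) M R) = ((d - 2 : ℕ) : WithBot ℕ∞)) :
    moduleDepth R ↥(extModule R (n - (d - 1)) M R) =
      moduleDepth R ↥(extModule R (n - d) M R) - 2 := by
  obtain ⟨hN, hG⟩ := hGor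
  haveI := hN
  have hk : ∀ i, i ≠ n → Aux.EV R (IsLocalRing.ResidueField R) R i := fun i hi =>
    (Aux.EV_iff _ _ i).2 ((hG n hn).1 i hi)
  letI : Algebra R A := π.toAlgebra
  have hs : Function.Surjective (algebraMap R A) := hπ
  haveI : IsScalarTower R A M := IsScalarTower.of_algebraMap_smul hcompat
  haveI : Module.Finite R A := Module.Finite.of_surjective (Algebra.linearMap R A) hs
  haveI : Module.Finite R M := Module.Finite.trans A M
  have hdR : Module.supportDim R M = d := (Aux.supportDim_change hs).trans hd
  have hdn : d ≤ n := by
    have := Module.supportDim_le_ringKrullDim R M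
    rw [hdR, hn] at this
    exact_mod_cast this
  obtain ⟨rs, hl, hm, hr⟩ := Aux.exists_lift_wreg hs (d - 1) hdepth (by omega)
  have hidx : n - (d - 1) = n - d + 1 := by omega
  rw [hidx] at hdimD ⊢
  haveI := Aux.finite_extModule (R := R) M R (n - d)
  haveI := Aux.finite_extModule (R := R) M R (n - d + 1)
  let P := projectiveResolution (ModuleCat.of R M)
  refine Aux.final d hd2 _ _ hdimD fun b hb => ?_
  obtain ⟨qK, hqK, hkK⟩ := Aux.ext_surj R P (n - d)
  obtain ⟨qD, hqD, hkD⟩ := Aux.ext_surj R P (n - d + 1)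
  exact Aux.main_complex (Aux.dd R P) (Aux.BB R P) rfl (fun _ => rfl) (Aux.BB_le R P) n d hdn
    (Aux.EV_GG n (fun i hi => hk i hi.ne) M P)
    (fun i hi => Aux.BB_eq_of_EV R P i (Aux.gor_low n hk M d hdR i (by omega)))
    (fun i hi => Aux.BB_eq_of_EV R P i
      (Aux.EV.cof_wreg n (fun X _ _ _ i hi => Aux.gor_high n hk X i hi) rs hm M hr i (by omega)))
    qK hqK hkK qD hqD hkD b hb
end
end

section
/- Let (A,m) be a quotient of a Gorenstein local ring R of dimension n, and M a finitely generated A-module of dimension d with depth(M) = d-1 and dim D^{d-1}(M) = d-2. Then D^{d-1}(M) is Cohen–Macaulay if and only if the canonical module K_M = D^d(M) is Cohen–Macaulay. -/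
open CategoryTheory

noncomputable section

namespace GorDual

/-- `Ext^i(M, N)` in the sense of derived categories. -/
abbrev EE (R : Type) [CommRing R] (N : Type) [AddCommGroup N] [Module R N] (i : ℕ) (M : Type)
    [AddCommGroup M] [Module R M] : Type :=
  Abelian.Ext (ModuleCat.of R M) (ModuleCat.of R N) i

section comparison

variable {R : Type} [CommRing R] {X Y : ModuleCat.{0} R} (P : ProjectiveResolution X)

lemma smul_extMk {n : ℕ} (r : R) (f : P.complex.X n ⟶ Y) (m : ℕ) (hm : n + 1 = m)
    (hf : P.complex.d m n ≫ f = 0) :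
    r • P.extMk f m hm hf = P.extMk (r • f) m hm (by simp [hf]) := by
  rw [Abelian.Ext.smul_eq_comp_mk₀, P.extMk_comp_mk₀]
  congr 1

lemma extMk_zero_inj (f : P.complex.X 0 ⟶ Y) (m : ℕ) (hm : 0 + 1 = m)
    (hf : P.complex.d m 0 ≫ f = 0) (h : P.extMk f m hm hf = 0) : f = 0 := by
  rw [← P.extEquivCohomologyClass.apply_eq_iff_eq,
    P.extEquivCohomologyClass_extMk, P.extEquivCohomologyClass_zero,
    CochainComplex.HomComplex.CohomologyClass.mk_eq_zero_iff] at h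
  rw [CochainComplex.HomComplex.Cocycle.toSingleMk_mem_coboundaries_iff _ _ _ _ _ (1) (by simp)] at h
  obtain ⟨g, hg⟩ := h
  have : Limits.IsZero (P.cochainComplex.X 1) := by
    exact CochainComplex.isZero_of_isStrictlyLE _ 0 1 (by simp)
  rw [this.eq_of_src g 0] at hg
  rw [← cancel_epi (P.cochainComplexXIso (-(0:ℕ)) 0 rfl).hom]
  simpa using hg.symm

/-- The short complex computing the `n`-th cohomology of `Hom(P, Y)`. -/
abbrev homSc (Y : ModuleCat.{0} R) (n : ℕ) : ShortComplex (ModuleCat.{0} R) :=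
  (P.complex.linearYonedaObj R Y).sc n

lemma next_eq (n : ℕ) : n + 1 = (ComplexShape.up ℕ).next n := by simp

/-- elements of the kernel viewed as morphisms -/
def cocyc (n : ℕ) (z : LinearMap.ker (homSc P Y n).g.hom) : P.complex.X n ⟶ Y := z.1

lemma cocyc_d (n : ℕ) (z : LinearMap.ker (homSc P Y n).g.hom) :
    P.complex.d ((ComplexShape.up ℕ).next n) n ≫ cocyc P n z = 0 := z.2

/-- cocycles to Ext -/
def cocyclesToExt (n : ℕ) :
    LinearMap.ker (homSc P Y n).g.hom →ₗ[R] Abelian.Ext X Y n where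
  toFun z := P.extMk (cocyc P n z) _ (next_eq n) (cocyc_d P n z)
  map_add' a b := by
    rw [P.add_extMk]
    rfl
  map_smul' r a := by
    rw [RingHom.id_apply, smul_extMk]
    rfl

lemma cocyclesToExt_surjective (n : ℕ) :
    Function.Surjective (cocyclesToExt (Y := Y) P n) := by
  intro α
  obtain ⟨f, hf, rfl⟩ := P.extMk_surjective α _ (next_eq n)
  exact ⟨⟨f, hf⟩, rfl⟩

lemma cocyclesToExt_ker (n : ℕ) :
    LinearMap.range (homSc P Y n).moduleCatToCycles =
    LinearMap.ker (cocyclesToExt (Y := Y) P n) := by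
  ext z
  rw [LinearMap.mem_ker]
  change _ ↔ P.extMk (cocyc P n z) _ (next_eq n) (cocyc_d P n z) = 0
  rcases n with _ | n
  · constructor
    · rintro ⟨y, rfl⟩
      have : cocyc P 0 ((homSc P Y 0).moduleCatToCycles y) = 0 := by
        have h0 : (homSc P Y 0).f = 0 :=
          (P.complex.linearYonedaObj R Y).shape _ _ (by simp)
        change (homSc P Y 0).f.hom y = 0
        rw [h0]; rfl
      simp only [this]
      simp
    · intro h
      have := extMk_zero_inj P _ _ _ _ h
      refine ⟨0, ?_⟩
      rw [map_zero]
      exact Subtype.ext this.symm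
  · have hp : n + 1 = n + 1 := rfl
    rw [P.extMk_eq_zero_iff _ _ _ _ n hp]
    have h1 : (ComplexShape.up ℕ).prev (n+1) = n := by simp
    have key : ∀ k, k = n → ((∃ g : P.complex.X n ⟶ Y, P.complex.d (n+1) n ≫ g = cocyc P (n+1) z) ↔
      (∃ g : P.complex.X k ⟶ Y, P.complex.d (n+1) k ≫ g = cocyc P (n+1) z)) := by
      rintro k rfl; rfl
    rw [key _ h1]
    constructor
    · rintro ⟨y, rfl⟩
      exact ⟨y, rfl⟩
    · rintro ⟨g, hg⟩
      exact ⟨g, Subtype.ext hg⟩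

/-- cohomology of `Hom(P, Y)` is Ext -/
def homologyEquivExt (n : ℕ) :
    (P.complex.linearYonedaObj R Y).homology n ≃ₗ[R] Abelian.Ext X Y n :=
  (homSc P Y n).moduleCatHomologyIso.toLinearEquiv ≪≫ₗ
  (Submodule.quotEquivOfEq _ _ (cocyclesToExt_ker P n)) ≪≫ₗ
  LinearMap.quotKerEquivOfSurjective _ (cocyclesToExt_surjective P n)

end comparison

/-- comparison of the two versions of Ext -/
def extModuleEquiv (R : Type) [CommRing R] (n : ℕ) (M N : Type) [AddCommGroup M] [Module R M]
    [AddCommGroup N] [Module R N] : extModule R n M N ≃ₗ[R] EE R N n M :=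
  ((projectiveResolution (ModuleCat.of R M)).isoExt (R := R) n (ModuleCat.of R N)).toLinearEquiv ≪≫ₗ
    homologyEquivExt _ n

end GorDual

namespace GorDual
open scoped Pointwise

section les
variable {R : Type} [CommRing R] (N : Type) [AddCommGroup N] [Module R N]
variable {M₁ M₂ M₃ : Type} [AddCommGroup M₁] [Module R M₁] [AddCommGroup M₂] [Module R M₂]
  [AddCommGroup M₃] [Module R M₃]

/-- functoriality of Ext in the first variable -/
def emap (i : ℕ) (f : M₁ →ₗ[R] M₂) : EE R N i M₂ →ₗ[R] EE R N i M₁ :=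
  (Abelian.Ext.mk₀ (ModuleCat.ofHom f)).precompOfLinear R (ModuleCat.of R N) (zero_add i)

lemma emap_comp (i : ℕ) (f : M₁ →ₗ[R] M₂) (g : M₂ →ₗ[R] M₃) (x : EE R N i M₃) :
    emap N i f (emap N i g x) = emap N i (g ∘ₗ f) x := by
  simp [emap]

lemma emap_id (i : ℕ) (x : EE R N i M₁) : emap N i LinearMap.id x = x := by
  change (Abelian.Ext.mk₀ (𝟙 (ModuleCat.of R M₁))).comp x (zero_add i) = x
  simp

lemma emap_smul (i : ℕ) (r : R) (x : EE R N i M₁) :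
    emap N i (LinearMap.lsmul R M₁ r) x = r • x := by
  change (Abelian.Ext.mk₀ (r • 𝟙 (ModuleCat.of R M₁))).comp x (zero_add i) = r • x
  rw [Abelian.Ext.mk₀_smul]
  simp

lemma ee_subsingleton (i : ℕ) [Subsingleton M₁] : Subsingleton (EE R N i M₁) := by
  refine subsingleton_of_forall_eq 0 fun x => ?_
  rw [← emap_id N i x]
  have : (LinearMap.id : M₁ →ₗ[R] M₁) = LinearMap.lsmul R M₁ 0 := by
    ext y; exact Subsingleton.elim _ _
  rw [this, emap_smul, zero_smul]

/-- Ext respects isomorphisms. -/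
def econgr (i : ℕ) (e : M₁ ≃ₗ[R] M₂) : EE R N i M₁ ≃ₗ[R] EE R N i M₂ :=
  LinearEquiv.ofLinearMap (emap N i e.symm.toLinearMap) (emap N i e.toLinearMap)
    (by ext x; simp only [LinearMap.comp_apply, LinearMap.id_apply]; rw [emap_comp]; simp [emap_id])
    (by ext x; simp only [LinearMap.comp_apply, LinearMap.id_apply]; rw [emap_comp]; simp [emap_id])

/-- `Ext^0 = Hom`. -/
def ezero : EE R N 0 M₁ ≃ₗ[R] (M₁ →ₗ[R] N) :=
  Abelian.Ext.linearEquiv₀.trans ModuleCat.homLinearEquiv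

lemma ee_projective (i : ℕ) [Module.Projective R M₁] : Subsingleton (EE R N (i+1) M₁) := by
  have : Projective (ModuleCat.of R M₁) := (ModuleCat.of R M₁).projective_of_categoryTheory_projective
  exact subsingleton_of_forall_eq 0 fun x => Abelian.Ext.eq_zero_of_projective x

theorem les {f : M₁ →ₗ[R] M₂} {g : M₂ →ₗ[R] M₃} (hf : Function.Injective f)
    (hg : Function.Surjective g) (hfg : Function.Exact f g) :
    ∃ δ : ∀ i, EE R N i M₁ →ₗ[R] EE R N (i+1) M₃,
      ∀ i, Function.Exact (emap N i g) (emap N i f) ∧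
        Function.Exact (emap N i f) (δ i) ∧ Function.Exact (δ i) (emap N (i+1) g) := by
  let S : ShortComplex (ModuleCat.{0} R) := ShortComplex.mk (ModuleCat.ofHom f) (ModuleCat.ofHom g)
    (by ext x; exact hfg.apply_apply_eq_zero x)
  have hS : S.ShortExact :=
    { exact := ModuleCat.shortComplex_exact _ hfg
      mono_f := (ModuleCat.mono_iff_injective _).mpr hf
      epi_g := (ModuleCat.epi_iff_surjective _).mpr hg }
  refine ⟨fun i => hS.extClass.precompOfLinear R (ModuleCat.of R N) (add_comm 1 i), fun i => ⟨?_, ?_, ?_⟩⟩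
  · exact (ShortComplex.ab_exact_iff_function_exact _).mp
      (Abelian.Ext.contravariant_sequence_exact₂' hS (ModuleCat.of R N) i)
  · exact (ShortComplex.ab_exact_iff_function_exact _).mp
      (Abelian.Ext.contravariant_sequence_exact₁' hS (ModuleCat.of R N) i (i+1) (add_comm 1 i))
  · exact (ShortComplex.ab_exact_iff_function_exact _).mp
      (Abelian.Ext.contravariant_sequence_exact₃' hS (ModuleCat.of R N) i (i+1) (add_comm 1 i))

lemma emap_zero_injective {g : M₂ →ₗ[R] M₃} (hg : Function.Surjective g) :
    Function.Injective (emap N 0 g) := by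
  have : Epi (ModuleCat.ofHom g) := (ModuleCat.epi_iff_surjective _).mpr hg
  exact Abelian.Ext.precomp_mk₀_injective_of_epi _ (ModuleCat.ofHom g)

theorem les_smul {x : R} (hx : IsSMulRegular M₁ x) :
    ∃ (a : ∀ i, EE R N i (QuotSMulTop x M₁) →ₗ[R] EE R N i M₁)
      (δ : ∀ i, EE R N i M₁ →ₗ[R] EE R N (i+1) (QuotSMulTop x M₁)),
      ∀ i, Function.Exact (a i) (LinearMap.lsmul R (EE R N i M₁) x) ∧
        Function.Exact (LinearMap.lsmul R (EE R N i M₁) x) (δ i) ∧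
        Function.Exact (δ i) (a (i+1)) := by
  obtain ⟨δ, h⟩ := les (R := R) N (f := LinearMap.lsmul R M₁ x)
    (g := (x • (⊤ : Submodule R M₁)).mkQ) hx (Submodule.mkQ_surjective _)
    (LinearMap.exact_lsmul_mkQ_smul_top M₁ x)
  refine ⟨fun i => emap N i (x • (⊤ : Submodule R M₁)).mkQ, δ, fun i => ?_⟩
  have : emap N i (LinearMap.lsmul R M₁ x) = LinearMap.lsmul R (EE R N i M₁) x := by
    ext1 y
    simp [emap_smul]
  rw [← this]
  exact h i

end les

end GorDual

namespace GorDual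
open scoped Pointwise
open IsLocalRing Module

section basics
variable {R : Type} [CommRing R]

lemma sub_of_exact {A B C : Type} [AddCommGroup A] [AddCommGroup B] [AddCommGroup C]
    [Module R A] [Module R B] [Module R C] {f : A →ₗ[R] B} {g : B →ₗ[R] C}
    (h : Function.Exact f g) [Subsingleton A] [Subsingleton C] : Subsingleton B := by
  refine subsingleton_of_forall_eq 0 fun x => ?_
  obtain ⟨y, rfl⟩ := (h x).mp (Subsingleton.elim _ _)
  rw [Subsingleton.elim y 0, map_zero]

lemma inj_of_exact {A B C : Type} [AddCommGroup A] [AddCommGroup B] [AddCommGroup C]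
    [Module R A] [Module R B] [Module R C] {f : A →ₗ[R] B} {g : B →ₗ[R] C}
    (h : Function.Exact f g) [Subsingleton A] : Function.Injective g := by
  rw [injective_iff_map_eq_zero]
  intro x hx
  obtain ⟨y, rfl⟩ := (h x).mp hx
  rw [Subsingleton.elim y 0, map_zero]

lemma surj_of_exact {A B C : Type} [AddCommGroup A] [AddCommGroup B] [AddCommGroup C]
    [Module R A] [Module R B] [Module R C] {f : A →ₗ[R] B} {g : B →ₗ[R] C}
    (h : Function.Exact f g) [Subsingleton C] : Function.Surjective f := by
  intro x
  exact (h x).mp (Subsingleton.elim _ _)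

lemma supportDim_le_of_exact {A B C : Type} [AddCommGroup A] [AddCommGroup B] [AddCommGroup C]
    [Module R A] [Module R B] [Module R C] {f : A →ₗ[R] B} {g : B →ₗ[R] C}
    (h : Function.Exact f g) {a : WithBot ℕ∞} (hA : supportDim R A ≤ a)
    (hC : supportDim R C ≤ a) : supportDim R B ≤ a := by
  refine iSup_le fun p => ?_
  have hsub : ∀ q ∈ support R B, q ∈ support R A ∨ q ∈ support R C := by
    intro q hq
    by_contra hcon
    push Not at hcon
    obtain ⟨h1, h2⟩ := hcon
    rw [Module.notMem_support_iff] at h1 h2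
    rw [Module.mem_support_iff, ← not_subsingleton_iff_nontrivial] at hq
    apply hq
    have := LocalizedModule.map_exact q.asIdeal.primeCompl f g h
    refine subsingleton_of_forall_eq 0 fun x => ?_
    obtain ⟨y, rfl⟩ := (this x).mp (Subsingleton.elim _ _)
    rw [Subsingleton.elim y 0, map_zero]
  have aux : ∀ (D : Type) [AddCommGroup D] [Module R D], supportDim R D ≤ a →
      (p.head : PrimeSpectrum R) ∈ support R D → (p.length : WithBot ℕ∞) ≤ a := by
    intro D _ _ hD hp
    let q : LTSeries (support R D) :=
      { length := p.length
        toFun := fun i => ⟨(p i).1, mem_support_mono (LTSeries.head_le p i) hp⟩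
        step := fun i => p.step i }
    exact (Order.LTSeries.length_le_krullDim q).trans hD
  rcases hsub _ p.head.2 with h' | h'
  · exact aux A hA h'
  · exact aux C hC h'

variable [IsLocalRing R]

lemma nakayama {E : Type} [AddCommGroup E] [Module R E] [Module.Finite R E] {x : R}
    (hx : x ∈ maximalIdeal R) (h : Function.Surjective (LinearMap.lsmul R E x)) :
    Subsingleton E := by
  rw [← Submodule.subsingleton_iff R]
  refine subsingleton_of_bot_eq_top ?_
  symm
  refine Submodule.eq_bot_of_le_smul_of_le_jacobson_bot (Ideal.span {x}) ⊤ Module.Finite.fg_top ?_ ?_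
  · intro y _
    obtain ⟨z, rfl⟩ := h y
    exact Submodule.smul_mem_smul (Ideal.mem_span_singleton_self x) trivial
  · rw [IsLocalRing.jacobson_eq_maximalIdeal ⊥ bot_ne_top]
    simpa [Ideal.span_le] using hx

theorem devissage [IsNoetherianRing R] (P : ∀ (M : Type) [AddCommGroup M] [Module R M], Prop)
    (h0 : ∀ (M : Type) [AddCommGroup M] [Module R M], Subsingleton M → P M)
    (hk : ∀ (M : Type) [AddCommGroup M] [Module R M], (M ≃ₗ[R] ResidueField R) → P M)
    (hreg : ∀ (M : Type) [AddCommGroup M] [Module R M], Module.Finite R M → ∀ x ∈ maximalIdeal R,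
      IsSMulRegular M x → P (QuotSMulTop x M) → P M)
    (hext : ∀ (M₁ M₂ M₃ : Type) [AddCommGroup M₁] [Module R M₁] [AddCommGroup M₂] [Module R M₂]
      [AddCommGroup M₃] [Module R M₃], Module.Finite R M₁ → Module.Finite R M₂ →
      Module.Finite R M₃ → ∀ (f : M₁ →ₗ[R] M₂) (g : M₂ →ₗ[R] M₃),
      Function.Injective f → Function.Surjective g → Function.Exact f g → P M₁ → P M₃ → P M₂)
    (n : ℕ) (hn : ringKrullDim R = n)
    (M : Type) [AddCommGroup M] [Module R M] [Module.Finite R M] : P M := by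
  have main : ∀ d : ℕ, ∀ (M : Type) [AddCommGroup M] [Module R M] [Module.Finite R M],
      supportDim R M < d → P M := by
    intro d
    induction d with
    | zero =>
      intro M _ _ _ h
      apply h0
      rw [← supportDim_eq_bot_iff_subsingleton (R := R)]
      by_contra hne
      have : Nontrivial M := supportDim_ne_bot_iff_nontrivial R M |>.mp hne
      have : (0 : WithBot ℕ∞) ≤ supportDim R M := by
        have : Nonempty (support R M) := nonempty_support_of_nontrivial.to_subtype
        exact Order.krullDim_nonneg
      exact absurd h (not_lt.mpr (by simpa using this))
    | succ d ih =>
      intro M _ _ hM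
      induction hM using IsNoetherianRing.induction_on_isQuotientEquivQuotientPrime R with
      | subsingleton N => exact fun _ => h0 N inferInstance
      | quotient N p e =>
        intro hd
        by_cases hp : p.1 = maximalIdeal R
        · apply hk
          exact e ≪≫ₗ Submodule.quotEquivOfEq _ _ hp
        · have hlt : ∃ x ∈ maximalIdeal R, x ∉ p.1 := by
            by_contra hcon
            push Not at hcon
            exact hp (le_antisymm (le_maximalIdeal p.2.ne_top) hcon)
          obtain ⟨x, hx, hxp⟩ := hlt
          have hr : IsSMulRegular N x := by
            intro a b hab
            apply e.injective
            have hab' : x • e a = x • e b := by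
              rw [← map_smul, ← map_smul]; exact congrArg e hab
            have := p.2
            rw [Algebra.smul_def, Algebra.smul_def] at hab'
            refine mul_left_cancel₀ ?_ hab'
            rwa [Ideal.Quotient.algebraMap_eq, Ne, Ideal.Quotient.eq_zero_iff_mem]
          refine hreg N inferInstance x hx hr (ih _ ?_)
          have h1 := supportDim_quotSMulTop_succ_eq_supportDim hr hx
          rw [← h1] at hd
          push_cast at hd
          exact lt_of_add_lt_add_right hd
      | exact N₁ N₂ N₃ f g hf hg hfg h₁ h₃ =>
        intro hd
        exact hext N₁ N₂ N₃ inferInstance inferInstance inferInstance f g hf hg hfg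
          (h₁ ((supportDim_le_of_injective f hf).trans_lt hd))
          (h₃ ((supportDim_le_of_surjective g hg).trans_lt hd))
  refine main (n+1) M (lt_of_le_of_lt (supportDim_le_ringKrullDim R M) ?_)
  rw [hn]
  exact_mod_cast Nat.lt_succ_self n

end basics

end GorDual

namespace GorDual
open scoped Pointwise
open IsLocalRing Module

/-- Usable form of the Gorenstein hypotheses. -/
structure Gor (R : Type) [CommRing R] [IsLocalRing R] (n : ℕ) : Prop where
  noeth : IsNoetherianRing R
  dim : ringKrullDim R = n
  van : ∀ i, i ≠ n → Subsingleton (EE R R i (ResidueField R))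
  top : Nonempty (EE R R n (ResidueField R) ≃ₗ[R] ResidueField R)

section gor
variable {R : Type} [CommRing R] [IsLocalRing R] {n : ℕ}

lemma wb_add_one_le {a : WithBot ℕ∞} {b : ℕ} (h : a + 1 ≤ (b : WithBot ℕ∞) + 1) : a ≤ b := by
  induction a using WithBot.recBotCoe with
  | bot => exact bot_le
  | coe a =>
    induction a using WithTop.recTopCoe with
    | top => exact absurd h (by
        rw [not_le]
        have : ((b + 1 : ℕ) : ℕ∞) < ⊤ := ENat.natCast_lt_top _
        have h2 := WithBot.coe_lt_coe.mpr this
        have h3 : (((⊤ : ℕ∞) : WithBot ℕ∞) + 1) = ((⊤ : ℕ∞) : WithBot ℕ∞) := rfl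
        exact h2)
    | coe a =>
      have h' : (a : WithBot ℕ∞) + 1 ≤ (b : WithBot ℕ∞) + 1 := h
      change (a : WithBot ℕ∞) ≤ b
      norm_cast at h' ⊢
      omega

lemma wb_add_one_eq {a : WithBot ℕ∞} {b : ℕ} (h : a + 1 = (b : WithBot ℕ∞) + 1) : a = b := by
  refine le_antisymm (wb_add_one_le h.le) ?_
  induction a using WithBot.recBotCoe with
  | bot => exact absurd h (by
      rw [WithBot.bot_add]
      exact_mod_cast WithBot.bot_ne_coe)
  | coe a =>
    induction a using WithTop.recTopCoe with
    | top => exact_mod_cast le_top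
    | coe a =>
      have h' : (a : WithBot ℕ∞) + 1 = (b : WithBot ℕ∞) + 1 := h
      change (b : WithBot ℕ∞) ≤ a
      norm_cast at h' ⊢
      omega

lemma supportDim_nonneg (E : Type) [AddCommGroup E] [Module R E] [Nontrivial E] :
    0 ≤ supportDim R E := by
  have : Nonempty (support R E) := nonempty_support_of_nontrivial.to_subtype
  exact Order.krullDim_nonneg

lemma supportDim_residue : supportDim R (ResidueField R) ≤ 0 := by
  have : supportDim R (R ⧸ maximalIdeal R) = ringKrullDim (R ⧸ maximalIdeal R) :=
    supportDim_quotient_eq_ringKrullDim _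
  change supportDim R (R ⧸ maximalIdeal R) ≤ 0
  rw [this]
  let := Ideal.Quotient.field (maximalIdeal R)
  exact (ringKrullDim_eq_zero_of_field _).le

lemma supportDim_sub {E : Type} [AddCommGroup E] [Module R E] [Subsingleton E]
    (b : WithBot ℕ∞) : supportDim R E ≤ b := by
  rw [(supportDim_eq_bot_iff_subsingleton R E).mpr ‹_›]; exact bot_le

/-- `dim Ext^i(M,R) ≤ n - i`. -/
theorem dim_ext_le (G : Gor R n) (M : Type) [AddCommGroup M] [Module R M] [Module.Finite R M] :
    ∀ i, (n < i → Subsingleton (EE R R i M)) ∧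
      ∀ b : ℕ, n ≤ b + i → supportDim R (EE R R i M) ≤ b := by
  have := G.noeth
  refine devissage (R := R) (fun M _ _ => ∀ i, (n < i → Subsingleton (EE R R i M)) ∧
      ∀ b : ℕ, n ≤ b + i → supportDim R (EE R R i M) ≤ b) ?_ ?_ ?_ ?_ n G.dim M
  · intro M _ _ h i
    have := ee_subsingleton (R := R) (M₁ := M) R i
    exact ⟨fun _ => this, fun b _ => supportDim_sub _⟩
  · intro M _ _ e i
    have e1 := econgr R i e
    by_cases hi : i = n
    · subst hi
      refine ⟨fun h => absurd h (lt_irrefl _), fun b _ => ?_⟩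
      rw [supportDim_eq_of_equiv (e1.trans G.top.some)]
      exact supportDim_residue.trans (by exact_mod_cast Nat.zero_le b)
    · have := G.van i hi
      have : Subsingleton (EE R R i M) := e1.toEquiv.subsingleton
      exact ⟨fun _ => this, fun b _ => supportDim_sub _⟩
  · intro M _ _ _ x hx hr ih i
    obtain ⟨a, δ, h⟩ := les_smul (R := R) R hr
    have key : n < i + 1 → Subsingleton (EE R R i M) := fun hi => by
      have := (ih (i+1)).1 hi
      exact nakayama hx (surj_of_exact (h i).2.1)
    refine ⟨fun hi => key (by omega), fun b hb => ?_⟩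
    rcases b with _ | b
    · have := key (by omega)
      exact supportDim_sub _
    · refine (supportDim_le_supportDim_quotSMulTop_succ hx).trans ?_
      have h2 := (ih (i+1)).2 b (by omega)
      have hle : x • (⊤ : Submodule R (EE R R i M)) ≤ LinearMap.ker (δ i) := by
        rintro _ ⟨y, _, rfl⟩
        exact (h i).2.1.apply_apply_eq_zero y
      have hinj : Function.Injective ((x • (⊤ : Submodule R (EE R R i M))).liftQ (δ i) hle) := by
        rw [← LinearMap.ker_eq_bot]
        refine Submodule.ker_liftQ_eq_bot _ _ _ ?_
        intro y hy
        obtain ⟨z, rfl⟩ := ((h i).2.1 y).mp hy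
        exact ⟨z, trivial, rfl⟩
      have h3 := (supportDim_le_of_injective (R := R) (M := QuotSMulTop x (EE R R i M)) _ hinj).trans h2
      push_cast
      gcongr
  · intro M₁ M₂ M₃ _ _ _ _ _ _ _ _ _ f g hf hg hfg h1 h3 i
    obtain ⟨δ, h⟩ := les (R := R) R hf hg hfg
    refine ⟨fun hi => ?_, fun b hb => ?_⟩
    · have := (h1 i).1 hi
      have := (h3 i).1 hi
      exact sub_of_exact (h i).1
    · exact supportDim_le_of_exact (h i).1 ((h3 i).2 b hb) ((h1 i).2 b hb)

/-- `Ext^i(M,R) = 0` for `i < n - dim M`. -/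
theorem ext_low (G : Gor R n) (M : Type) [AddCommGroup M] [Module R M] [Module.Finite R M] :
    ∀ a i : ℕ, supportDim R M ≤ a → a + i < n → Subsingleton (EE R R i M) := by
  have := G.noeth
  refine devissage (R := R) (fun M _ _ => ∀ a i : ℕ, supportDim R M ≤ a → a + i < n →
    Subsingleton (EE R R i M)) ?_ ?_ ?_ ?_ n G.dim M
  · intro M _ _ h a i _ _
    exact ee_subsingleton (R := R) (M₁ := M) R i
  · intro M _ _ e a i _ hi
    have e1 := econgr R i e
    have := G.van i (by omega)
    exact e1.toEquiv.subsingleton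
  · intro M _ _ _ x hx hr ih a i ha hi
    obtain ⟨a', δ, h⟩ := les_smul (R := R) R hr
    have key : Subsingleton (EE R R (i+1) (QuotSMulTop x M)) := by
      have h1 := supportDim_quotSMulTop_succ_eq_supportDim hr hx
      rw [← h1] at ha
      rcases a with _ | a
      · have : Subsingleton (QuotSMulTop x M) := by
          by_contra hne
          rw [not_subsingleton_iff_nontrivial] at hne
          have h0 := supportDim_nonneg (R := R) (QuotSMulTop x M)
          have h2 : (0 : WithBot ℕ∞) + 1 ≤ 0 := le_trans (by gcongr) ha
          rw [zero_add] at h2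
          exact absurd h2 (by decide)
        exact ee_subsingleton R _
      · refine ih a (i+1) ?_ (by omega)
        push_cast at ha
        exact wb_add_one_le ha
    exact nakayama hx (surj_of_exact (h i).2.1)
  · intro M₁ M₂ M₃ _ _ _ _ _ _ _ _ _ f g hf hg hfg h1 h3 a i ha hi
    obtain ⟨δ, h⟩ := les (R := R) R hf hg hfg
    have := h1 a i ((supportDim_le_of_injective f hf).trans ha) hi
    have := h3 a i ((supportDim_le_of_surjective g hg).trans ha) hi
    exact sub_of_exact (h i).1

open RingTheory.Sequence in
/-- depth gives vanishing -/
theorem ext_high (G : Gor R n) (rs : List R) : ∀ (M : Type) [AddCommGroup M] [Module R M]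
    [Module.Finite R M], (∀ r ∈ rs, r ∈ maximalIdeal R) → IsWeaklyRegular M rs →
    ∀ i, n < i + rs.length → Subsingleton (EE R R i M) := by
  have := G.noeth
  induction rs with
  | nil => intro M _ _ _ _ _ i hi; exact (dim_ext_le G M i).1 (by simpa using hi)
  | cons x rs ih =>
    intro M _ _ _ hm hr i hi
    rw [isWeaklyRegular_cons_iff] at hr
    obtain ⟨a, δ, h⟩ := les_smul (R := R) R hr.1
    have := ih (QuotSMulTop x M) (fun r h => hm r (by simp [h])) hr.2 (i+1)
      (by simp at hi; omega)
    exact nakayama (hm x (by simp)) (surj_of_exact (h i).2.1)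

open RingTheory.Sequence in
/-- vanishing gives depth -/
theorem exists_regular (G : Gor R n) (t : ℕ) : ∀ (M : Type) [AddCommGroup M] [Module R M]
    [Module.Finite R M] [Nontrivial M], (∀ i, n < i + t → Subsingleton (EE R R i M)) →
    ∃ rs : List R, rs.length = t ∧ (∀ r ∈ rs, r ∈ maximalIdeal R) ∧ IsRegular M rs := by
  have := G.noeth
  induction t with
  | zero =>
    intro M _ _ _ _ _
    exact ⟨[], rfl, by simp, IsRegular.nil R M⟩
  | succ t ih =>
    intro M _ _ _ _ hv
    have hx : ∃ x ∈ maximalIdeal R, IsSMulRegular M x := by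
      by_contra hcon
      have hns : ¬ Subsingleton (ResidueField R →ₗ[R] M) := by
        rw [IsSMulRegular.subsingleton_linearMap_iff]
        rintro ⟨r, hr, hreg⟩
        refine hcon ⟨r, ?_, hreg⟩
        have : annihilator R (R ⧸ maximalIdeal R) = maximalIdeal R := Ideal.annihilator_quotient
        rwa [← this]
      rw [not_subsingleton_iff_nontrivial] at hns
      obtain ⟨f, hf⟩ := exists_ne (0 : ResidueField R →ₗ[R] M)
      have hinj : Function.Injective f := by
        rw [← LinearMap.ker_eq_bot, eq_bot_iff]
        intro y hy
        by_contra hy0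
        apply hf
        refine LinearMap.ext fun z => ?_
        obtain ⟨r, hr⟩ := residue_surjective (z * y⁻¹ : ResidueField R)
        have h1 : z = r • y := by
          have : r • y = residue R r * y := Algebra.smul_def r y
          rw [this, hr, inv_mul_cancel_right₀ hy0]
        rw [h1, map_smul, LinearMap.mem_ker.mp hy, smul_zero, LinearMap.zero_apply]
      obtain ⟨δ, h⟩ := les (R := R) R hinj (LinearMap.range f).mkQ_surjective
        (LinearMap.exact_map_mkQ_range f)
      have := hv n (by omega)
      have := (dim_ext_le G (M ⧸ LinearMap.range f) (n+1)).1 (by omega)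
      have h2 : Subsingleton (EE R R n (ResidueField R)) := sub_of_exact (h n).2.1
      have := G.top.some.symm.toEquiv.subsingleton
      exact not_subsingleton (ResidueField R) this
    obtain ⟨x, hx, hreg⟩ := hx
    obtain ⟨a, δ, h⟩ := les_smul (R := R) R hreg
    have hnt : Nontrivial (QuotSMulTop x M) := nontrivial_quotSMulTop_of_mem_maximalIdeal M hx
    obtain ⟨rs, hl, hm, hrs⟩ := ih (QuotSMulTop x M) (fun i hi => by
      rcases i with _ | i
      · have := hv 0 (by omega)
        exact (emap_zero_injective R (Submodule.mkQ_surjective (x • (⊤ : Submodule R M)))).subsingleton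
      · have := hv i (by omega)
        have := hv (i+1) (by omega)
        exact sub_of_exact (h i).2.2)
    refine ⟨x :: rs, by simp [hl], ?_, ?_⟩
    · intro r hr
      rcases List.mem_cons.mp hr with rfl | hr
      · exact hx
      · exact hm r hr
    · rw [isRegular_cons_iff]
      exact ⟨hreg, hrs⟩

open RingTheory.Sequence in
/-- nonvanishing at `n - dim M` -/
theorem ext_nontrivial (G : Gor R n) (M : Type) [AddCommGroup M] [Module R M]
    [Module.Finite R M] (d c : ℕ) (hd : supportDim R M = d) (hc : c + d = n) :
    Nontrivial (EE R R c M) := by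
  have := G.noeth
  by_contra hcon
  rw [not_nontrivial_iff_subsingleton] at hcon
  have hlow : ∀ i < c + 1, Subsingleton (EE R R i M) := by
    intro i hi
    rcases Nat.lt_succ_iff_lt_or_eq.mp hi with h | rfl
    · exact ext_low G M d i hd.le (by omega)
    · exact hcon
  have hnt : Nontrivial M := by
    rw [← supportDim_ne_bot_iff_nontrivial R M, hd]
    exact_mod_cast WithBot.coe_ne_bot
  have hne : annihilator R M ≠ ⊤ := by
    rw [Ne, annihilator_eq_top_iff, not_subsingleton_iff_nontrivial]
    exact hnt
  obtain ⟨rs, hl, hmem, hr⟩ := ModuleCat.exists_isRegular_of_exists_subsingleton_ext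
    (annihilator R M) (c+1) (ModuleCat.of R R)
    (by rw [smul_eq_mul, Ideal.mul_top]; exact lt_top_iff_ne_top.mpr hne) (ModuleCat.of R M)
    (support_eq_zeroLocus) hlow
  have h1 := ringKrullDim_add_length_eq_ringKrullDim_of_isRegular rs hr
  rw [G.dim, hl] at h1
  have hle : Ideal.ofList rs ≤ annihilator R M := Ideal.span_le.mpr hmem
  have h2 := ringKrullDim_le_of_surjective _ (Ideal.Quotient.factor_surjective hle)
  rw [← supportDim_eq_ringKrullDim_quotient_annihilator, hd] at h2
  have h3 : (d : WithBot ℕ∞) + (c + 1 : ℕ) ≤ n := by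
    rw [← h1]; gcongr
  norm_cast at h3
  omega

open RingTheory.Sequence in
theorem cm_dim (G : Gor R n) (rs : List R) : ∀ (K : Type) [AddCommGroup K] [Module R K]
    [Module.Finite R K], (∀ r ∈ rs, r ∈ maximalIdeal R) → IsRegular K rs →
    supportDim R K = rs.length → ∀ c, c + rs.length = n →
    (rs.length : WithBot ℕ∞) ≤ supportDim R (EE R R c K) := by
  have := G.noeth
  induction rs with
  | nil =>
    intro K _ _ _ _ hr hK c hc
    have := ext_nontrivial G K 0 c (by simpa using hK) (by simpa using hc)
    simpa using supportDim_nonneg (R := R) (EE R R c K)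
  | cons x rs ih =>
    intro K _ _ _ hm hr hK c hc
    have hr0 := hr
    rw [isRegular_cons_iff] at hr
    have hx := hm x (by simp)
    have hdim := supportDim_quotSMulTop_succ_eq_supportDim hr.1 hx
    have hdim' : supportDim R (QuotSMulTop x K) = rs.length := by
      rw [hK] at hdim
      push_cast [List.length_cons] at hdim
      exact wb_add_one_eq hdim
    simp only [List.length_cons] at hc
    obtain ⟨a, δ, h⟩ := les_smul (R := R) R hr.1
    have e1 : Subsingleton (EE R R c (QuotSMulTop x K)) :=
      ext_low G _ rs.length c hdim'.le (by omega)
    have e2 : Subsingleton (EE R R (c+1) K) :=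
      ext_high G (x :: rs) K hm hr0.toIsWeaklyRegular (c+1) (by simp; omega)
    have hreg : IsSMulRegular (EE R R c K) x := inj_of_exact (h c).1
    have hsurj : Function.Surjective (δ c) := surj_of_exact (h c).2.2
    have := ih (QuotSMulTop x K) (fun r h => hm r (by simp [h])) hr.2 hdim' (c+1) (by omega)
    rw [← supportDim_quotSMulTop_succ_eq_supportDim hreg hx]
    have hle : x • (⊤ : Submodule R (EE R R c K)) ≤ LinearMap.ker (δ c) := by
      rintro _ ⟨y, _, rfl⟩
      exact (h c).2.1.apply_apply_eq_zero y
    have h3 := supportDim_le_of_surjective (R := R) (M := QuotSMulTop x (EE R R c K))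
      ((x • (⊤ : Submodule R (EE R R c K))).liftQ (δ c) hle) (fun y => by
        obtain ⟨z, rfl⟩ := hsurj y
        exact ⟨Submodule.Quotient.mk z, rfl⟩)
    push_cast [List.length_cons]
    gcongr
    exact this.trans h3

end gor
end GorDual

namespace GorDual
open scoped Pointwise
open IsLocalRing Module

section shift
variable {R : Type} [CommRing R]
variable {X Y Z : Type} [AddCommGroup X] [Module R X] [AddCommGroup Y] [Module R Y]
  [AddCommGroup Z] [Module R Z] {f : X →ₗ[R] Y} {g : Y →ₗ[R] Z}

lemma shiftXZ (hf : Function.Injective f) (hg : Function.Surjective g) (hfg : Function.Exact f g)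
    (i : ℕ) (h1 : Subsingleton (EE R R i Y)) (h2 : Subsingleton (EE R R (i+1) Y)) :
    Nonempty (EE R R i X ≃ₗ[R] EE R R (i+1) Z) := by
  obtain ⟨δ, h⟩ := les (R := R) R hf hg hfg
  exact ⟨LinearEquiv.ofBijective (δ i) ⟨inj_of_exact (h i).2.1, surj_of_exact (h i).2.2⟩⟩

lemma isoYX (hf : Function.Injective f) (hg : Function.Surjective g) (hfg : Function.Exact f g)
    (i : ℕ) (h1 : Subsingleton (EE R R i Z)) (h2 : Subsingleton (EE R R (i+1) Z)) :
    Nonempty (EE R R i Y ≃ₗ[R] EE R R i X) := by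
  obtain ⟨δ, h⟩ := les (R := R) R hf hg hfg
  exact ⟨LinearEquiv.ofBijective (emap R i f) ⟨inj_of_exact (h i).1, surj_of_exact (h i).2.1⟩⟩

lemma isoZY (hf : Function.Injective f) (hg : Function.Surjective g) (hfg : Function.Exact f g)
    (i : ℕ) (h1 : Subsingleton (EE R R i X)) (h2 : Subsingleton (EE R R (i+1) X)) :
    Nonempty (EE R R (i+1) Z ≃ₗ[R] EE R R (i+1) Y) := by
  obtain ⟨δ, h⟩ := les (R := R) R hf hg hfg
  exact ⟨LinearEquiv.ofBijective (emap R (i+1) g)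
    ⟨inj_of_exact (h i).2.2, surj_of_exact (h (i+1)).1⟩⟩

lemma subZ (hf : Function.Injective f) (hg : Function.Surjective g) (hfg : Function.Exact f g)
    (i : ℕ) (h1 : Subsingleton (EE R R i X)) (h2 : Subsingleton (EE R R (i+1) Y)) :
    Subsingleton (EE R R (i+1) Z) := by
  obtain ⟨δ, h⟩ := les (R := R) R hf hg hfg
  exact sub_of_exact (h i).2.2

lemma sub_congr (e : Nonempty (X ≃ₗ[R] Y)) (h : Subsingleton Y) : Subsingleton X :=
  e.some.toEquiv.subsingleton

end shift

section syz
variable {R : Type} [CommRing R] {m : ℕ}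
variable {M : Type} [AddCommGroup M] [Module R M] (g : (Fin m → R) →ₗ[R] M)

lemma dual_free_sub (i : ℕ) : Subsingleton (EE R R (i+1) (EE R R 0 (Fin m → R))) := by
  have : Module.Projective R (EE R R 0 (Fin m → R)) :=
    Module.Projective.of_equiv (ezero (R := R) (M₁ := Fin m → R) R).symm
  exact ee_projective R i

lemma syz_shift (hg : Function.Surjective g) (i : ℕ) :
    Nonempty (EE R R (i+1) (LinearMap.ker g) ≃ₗ[R] EE R R (i+2) M) :=
  shiftXZ (f := (LinearMap.ker g).subtype) Subtype.val_injective hg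
    (LinearMap.exact_subtype_ker_map g) (i+1) (ee_projective R i) (ee_projective R (i+1))

/-- The image of the dual of the free module in the dual of the syzygy. -/
abbrev BB : Submodule R (EE R R 0 (LinearMap.ker g)) :=
  LinearMap.range (emap R 0 (LinearMap.ker g).subtype)

/-- the sequence `0 → M* → F* → B → 0` -/
lemma seq1 (hg : Function.Surjective g) :
    Function.Injective (emap R 0 g) ∧
    Function.Surjective (emap R 0 (LinearMap.ker g).subtype).rangeRestrict ∧
    Function.Exact (emap R 0 g) (emap R 0 (LinearMap.ker g).subtype).rangeRestrict := by
  obtain ⟨δ, h⟩ := les (R := R) R (f := (LinearMap.ker g).subtype) Subtype.val_injective hg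
    (LinearMap.exact_subtype_ker_map g)
  refine ⟨emap_zero_injective R hg, LinearMap.surjective_rangeRestrict _, fun y => ?_⟩
  rw [← (h 0).1 y]
  exact Subtype.ext_iff

/-- the sequence `0 → B → (ker g)* → Ext^1(M) → 0` -/
lemma seq2 (hg : Function.Surjective g) :
    ∃ δ : EE R R 0 (LinearMap.ker g) →ₗ[R] EE R R 1 M,
    Function.Injective (BB g).subtype ∧ Function.Surjective δ ∧
      Function.Exact (BB g).subtype δ := by
  obtain ⟨δ, h⟩ := les (R := R) R (f := (LinearMap.ker g).subtype) Subtype.val_injective hg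
    (LinearMap.exact_subtype_ker_map g)
  have := ee_projective (R := R) (M₁ := Fin m → R) R 0
  refine ⟨δ 0, Subtype.val_injective, surj_of_exact (h 0).2.2, fun y => ?_⟩
  rw [(h 0).2.1 y]
  simp

lemma B_shift (hg : Function.Surjective g) (j : ℕ) :
    Nonempty (EE R R (j+1) (EE R R 0 M) ≃ₗ[R] EE R R (j+2) (BB g)) := by
  obtain ⟨h1, h2, h3⟩ := seq1 g hg
  exact shiftXZ h1 h2 h3 (j+1) (dual_free_sub j) (dual_free_sub (j+1))

lemma B_sub (hg : Function.Surjective g) (j : ℕ) (h : Subsingleton (EE R R j (EE R R 0 M))) :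
    Subsingleton (EE R R (j+1) (BB g)) := by
  obtain ⟨h1, h2, h3⟩ := seq1 g hg
  exact subZ h1 h2 h3 j h (dual_free_sub j)

lemma B_iso (hg : Function.Surjective g) (h : Subsingleton (EE R R 1 M)) (j : ℕ) :
    Nonempty (EE R R j (EE R R 0 (LinearMap.ker g)) ≃ₗ[R] EE R R j (BB g)) := by
  obtain ⟨δ, h1, h2, h3⟩ := seq2 g hg
  exact isoYX h1 h2 h3 j (ee_subsingleton R j) (ee_subsingleton R (j+1))

end syz

section key
variable {R : Type} [CommRing R] [IsLocalRing R] {n : ℕ}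

theorem dual_acyclic (G : Gor R n) (k : ℕ) : ∀ (X : Type) [AddCommGroup X] [Module R X]
    [Module.Finite R X], (∀ i, Subsingleton (EE R R (i+1) X)) →
    ∀ j, n < j + 1 + k → Subsingleton (EE R R (j+1) (EE R R 0 X)) := by
  have := G.noeth
  induction k with
  | zero => intro X _ _ _ _ j hj; exact (dim_ext_le G _ (j+1)).1 hj
  | succ k ih =>
    intro X _ _ _ hX j hj
    obtain ⟨m, g, hg⟩ := Module.Finite.exists_fin' R X
    refine sub_congr (B_shift g hg j) ?_
    refine sub_congr ⟨(B_iso g hg (hX 0) (j+2)).some.symm⟩ ?_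
    refine ih (LinearMap.ker g) (fun i => ?_) (j+1) (by omega)
    exact sub_congr (syz_shift g hg i) (hX (i+1))

theorem key0 (G : Gor R n) (M : Type) [AddCommGroup M] [Module R M]
    [Module.Finite R M] (hM : ∀ i, Subsingleton (EE R R (i+2) M)) (j : ℕ) :
    Nonempty (EE R R (j+1) (EE R R 0 M) ≃ₗ[R] EE R R (j+3) (EE R R 1 M)) := by
  have := G.noeth
  obtain ⟨m, g, hg⟩ := Module.Finite.exists_fin' R M
  have hac : ∀ i, Subsingleton (EE R R (i+1) (LinearMap.ker g)) := fun i =>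
    sub_congr (syz_shift g hg i) (hM i)
  have hd : ∀ j, Subsingleton (EE R R (j+1) (EE R R 0 (LinearMap.ker g))) := fun j =>
    dual_acyclic G n _ hac j (by omega)
  obtain ⟨δ, h1, h2, h3⟩ := seq2 g hg
  obtain ⟨e⟩ := shiftXZ h1 h2 h3 (j+2) (hd (j+1)) (hd (j+2))
  obtain ⟨e'⟩ := B_shift g hg j
  exact ⟨e'.trans e⟩

theorem keyc (G : Gor R n) (c : ℕ) : ∀ (k : ℕ) (M : Type) [AddCommGroup M] [Module R M]
    [Module.Finite R M], (∀ i, 1 ≤ i → i < c + 1 → Subsingleton (EE R R i M)) →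
    (∀ i, c + 3 ≤ i → Subsingleton (EE R R i M)) →
    (∀ j, k ≤ j → Subsingleton (EE R R j (EE R R 0 M))) →
    ∀ j, c + k + 2 ≤ j →
    Nonempty (EE R R j (EE R R (c+1) M) ≃ₗ[R] EE R R (j+2) (EE R R (c+2) M)) := by
  have := G.noeth
  induction c with
  | zero =>
    intro k M _ _ _ _ h2 h3 j hj
    obtain ⟨m, g, hg⟩ := Module.Finite.exists_fin' R M
    obtain ⟨j, rfl⟩ : ∃ j', j = j' + 2 := ⟨j - 2, by omega⟩
    obtain ⟨δ, s1, s2, s3⟩ := seq2 g hg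
    obtain ⟨e1⟩ := isoZY s1 s2 s3 (j+1) (B_sub g hg j (h3 _ (by omega)))
      (B_sub g hg (j+1) (h3 _ (by omega)))
    obtain ⟨e2⟩ := key0 G (LinearMap.ker g)
      (fun i => sub_congr (syz_shift g hg (i+1)) (h2 _ (by omega))) (j+1)
    obtain ⟨e3⟩ := syz_shift g hg 0
    exact ⟨(e1.trans e2).trans (econgr R _ e3)⟩
  | succ c ih =>
    intro k M _ _ _ h1 h2 h3 j hj
    obtain ⟨m, g, hg⟩ := Module.Finite.exists_fin' R M
    have h11 := h1 1 le_rfl (by omega)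
    obtain ⟨e⟩ := ih (k+1) (LinearMap.ker g)
      (fun i hi hi' => by
        obtain ⟨i, rfl⟩ : ∃ i', i = i' + 1 := ⟨i - 1, by omega⟩
        exact sub_congr (syz_shift g hg i) (h1 _ (by omega) (by omega)))
      (fun i hi => by
        obtain ⟨i, rfl⟩ : ∃ i', i = i' + 1 := ⟨i - 1, by omega⟩
        exact sub_congr (syz_shift g hg i) (h2 _ (by omega)))
      (fun j hj => by
        obtain ⟨j, rfl⟩ : ∃ i', j = i' + 1 := ⟨j - 1, by omega⟩
        exact sub_congr (B_iso g hg h11 _) (B_sub g hg j (h3 _ (by omega)))) j (by omega)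
    obtain ⟨e1⟩ := syz_shift g hg c
    obtain ⟨e2⟩ := syz_shift g hg (c+1)
    exact ⟨((econgr R _ e1.symm).trans e).trans (econgr R _ e2)⟩

theorem key (G : Gor R n) (c : ℕ) (M : Type) [AddCommGroup M] [Module R M]
    [Module.Finite R M] (h1 : ∀ i, i < c → Subsingleton (EE R R i M))
    (h2 : ∀ i, c + 2 ≤ i → Subsingleton (EE R R i M)) (j : ℕ) (hj : c + 1 ≤ j) :
    Nonempty (EE R R j (EE R R c M) ≃ₗ[R] EE R R (j+2) (EE R R (c+1) M)) := by
  rcases c with _ | c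
  · obtain ⟨j, rfl⟩ : ∃ i', j = i' + 1 := ⟨j - 1, by omega⟩
    exact key0 G M (fun i => h2 _ (by omega)) j
  · have := h1 0 (by omega)
    exact keyc G c 0 M (fun i _ hi => h1 i hi) h2 (fun j _ => ee_subsingleton R j) j (by omega)

end key
end GorDual

namespace GorDual
open scoped Pointwise
open IsLocalRing Module RingTheory.Sequence

section cm
variable {R : Type} [CommRing R] [IsLocalRing R]

lemma isCM_congr {E F : Type} [AddCommGroup E] [Module R E] [AddCommGroup F] [Module R F]
    (e : E ≃ₗ[R] F) : IsCM R E ↔ IsCM R F := by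
  have h1 : moduleDim R E = moduleDim R F := supportDim_eq_of_equiv e
  have h2 : moduleDepth R E = moduleDepth R F := by
    unfold moduleDepth
    simp only [e.isRegular_congr]
  unfold IsCM
  rw [h1, h2, e.toEquiv.subsingleton_congr]

lemma exists_of_depth {M : Type} [AddCommGroup M] [Module R M] [Nontrivial M]
    {t : ℕ} (h : moduleDepth R M = t) : ∃ rs : List R, rs.length = t ∧
    (∀ r ∈ rs, r ∈ maximalIdeal R) ∧ IsRegular M rs := by
  have hne : {n : ℕ∞ | ∃ rs : List R, (rs.length : ℕ∞) = n ∧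
    (∀ r ∈ rs, r ∈ IsLocalRing.maximalIdeal R) ∧ RingTheory.Sequence.IsRegular M rs}.Nonempty :=
    ⟨0, [], by simp, by simp, IsRegular.nil R M⟩
  have := hne.to_subtype
  have := ENat.sSup_mem_of_nonempty_of_lt_top (by
    exact (h.trans_lt (ENat.natCast_lt_top _) : moduleDepth R M < ⊤))
  change ∃ rs : List R, (rs.length : ℕ∞) = moduleDepth R M ∧ _ at this
  obtain ⟨rs, h1, h2⟩ := this
  rw [h] at h1
  exact ⟨rs, by exact_mod_cast h1, h2⟩

lemma length_le [IsNoetherianRing R] {E : Type} [AddCommGroup E] [Module R E] [Module.Finite R E]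
    {rs : List R} (hr : IsRegular E rs) : (rs.length : WithBot ℕ∞) ≤ supportDim R E := by
  rw [← supportDim_add_length_eq_supportDim_of_isRegular rs hr]
  have : Nontrivial (E ⧸ Ideal.ofList rs • (⊤ : Submodule R E)) :=
    Submodule.Quotient.nontrivial_iff.mpr hr.2.symm
  calc (rs.length : WithBot ℕ∞) = 0 + rs.length := (zero_add _).symm
    _ ≤ _ := by gcongr; exact supportDim_nonneg _

lemma cm_of_regular [IsNoetherianRing R] {E : Type} [AddCommGroup E] [Module R E]
    [Module.Finite R E] {rs : List R} (hm : ∀ r ∈ rs, r ∈ maximalIdeal R) (hr : IsRegular E rs)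
    (hd : supportDim R E ≤ rs.length) : IsCM R E := by
  right
  have h1 : moduleDim R E = rs.length := le_antisymm hd (length_le hr)
  have h2 : moduleDepth R E = rs.length := by
    refine le_antisymm (sSup_le ?_) (le_sSup ⟨rs, rfl, hm, hr⟩)
    rintro _ ⟨rs', rfl, hm', hr'⟩
    have := (length_le hr').trans hd
    exact_mod_cast this
  rw [h1, h2]
  rfl

lemma regular_of_cm [IsNoetherianRing R] {E : Type} [AddCommGroup E] [Module R E]
    [Module.Finite R E] [Nontrivial E] (h : IsCM R E) {b : ℕ} (hb : supportDim R E ≤ b) :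
    ∃ rs : List R, (∀ r ∈ rs, r ∈ maximalIdeal R) ∧ IsRegular E rs ∧
      supportDim R E = rs.length := by
  have h' : supportDim R E = (moduleDepth R E : WithBot ℕ∞) := by
    rcases h with h | h
    · exact absurd h (not_subsingleton E)
    · exact h
  obtain ⟨t, ht⟩ : ∃ t : ℕ, moduleDepth R E = t := by
    rw [h'] at hb
    have : moduleDepth R E ≤ (b : ℕ∞) := WithBot.coe_le_coe.mp hb
    obtain ⟨t, ht, _⟩ := ENat.le_natCast_iff.mp this
    exact ⟨t, ht⟩
  obtain ⟨rs, h1, h2, h3⟩ := exists_of_depth ht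
  refine ⟨rs, h2, h3, ?_⟩
  rw [h', ht, h1]
  rfl

lemma supportDim_restrict {A : Type} [CommRing A] [Algebra R A]
    (hs : Function.Surjective (algebraMap R A)) (M : Type) [AddCommGroup M] [Module A M]
    [Module R M] [IsScalarTower R A M] [Module.Finite A M] [Module.Finite R M] :
    supportDim R M = supportDim A M := by
  rw [supportDim_eq_ringKrullDim_quotient_annihilator,
    supportDim_eq_ringKrullDim_quotient_annihilator]
  let f : R →+* A ⧸ annihilator A M := (Ideal.Quotient.mk _).comp (algebraMap R A)
  have hf : Function.Surjective f := Ideal.Quotient.mk_surjective.comp hs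
  have hk : annihilator R M = RingHom.ker f := by
    ext r
    rw [RingHom.mem_ker, RingHom.comp_apply, Ideal.Quotient.eq_zero_iff_mem, mem_annihilator,
      mem_annihilator]
    simp
  exact ringKrullDim_eq_of_ringEquiv
    ((Ideal.quotEquivOfEq hk).trans (RingHom.quotientKerEquivOfSurjective hf))

lemma lift_list {A : Type} [CommRing A] [IsLocalRing A] [Algebra R A]
    (hs : Function.Surjective (algebraMap R A)) (rs : List A)
    (hm : ∀ r ∈ rs, r ∈ maximalIdeal A) :
    ∃ rs' : List R, rs'.map (algebraMap R A) = rs ∧ ∀ r ∈ rs', r ∈ maximalIdeal R := by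
  induction rs with
  | nil => exact ⟨[], rfl, by simp⟩
  | cons x rs ih =>
    obtain ⟨rs', h1, h2⟩ := ih (fun r h => hm r (by simp [h]))
    obtain ⟨y, rfl⟩ := hs x
    refine ⟨y :: rs', by simp [h1], ?_⟩
    intro r hr
    rcases List.mem_cons.mp hr with rfl | hr
    · have := hm (algebraMap R A r) (by simp)
      rw [mem_maximalIdeal, mem_nonunits_iff] at this ⊢
      exact fun hu => this (hu.map _)
    · exact h2 r hr

/-- The main theorem in terms of `EE`. -/
theorem main {n : ℕ} (G : Gor R n) (M : Type) [AddCommGroup M] [Module R M] [Module.Finite R M]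
    (c e : ℕ) (hn : c + (e + 2) = n) (hd : supportDim R M = (e + 2 : ℕ))
    (rs : List R) (hl : rs.length = e + 1) (hm : ∀ r ∈ rs, r ∈ maximalIdeal R)
    (hr : IsWeaklyRegular M rs) (hN : supportDim R (EE R R (c+1) M) = (e : ℕ)) :
    IsCM R (EE R R (c+1) M) ↔ IsCM R (EE R R c M) := by
  have := G.noeth
  have hlow : ∀ i, i < c → Subsingleton (EE R R i M) := fun i hi =>
    ext_low G M (e+2) i hd.le (by omega)
  have hhigh : ∀ i, c + 2 ≤ i → Subsingleton (EE R R i M) := fun i hi =>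
    ext_high G rs M hm hr i (by omega)
  have hkey := key G c M hlow hhigh
  have hK : Nontrivial (EE R R c M) := ext_nontrivial G M (e+2) c hd hn
  have hNn : Nontrivial (EE R R (c+1) M) := by
    rw [← supportDim_ne_bot_iff_nontrivial R, hN]
    exact_mod_cast WithBot.coe_ne_bot
  have hKd : supportDim R (EE R R c M) ≤ (e + 2 : ℕ) :=
    (dim_ext_le G M c).2 (e+2) (by omega)
  constructor
  · intro h
    obtain ⟨rs', hm', hr', hd'⟩ := regular_of_cm h hN.le
    have hl' : rs'.length = e := by rw [hN] at hd'; exact_mod_cast hd'.symm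
    obtain ⟨qs, h1, h2, h3⟩ := exists_regular G (e+2) (EE R R c M) (fun i hi =>
      sub_congr (hkey i (by omega)) (ext_high G rs' _ hm' hr'.toIsWeaklyRegular _ (by omega)))
    exact cm_of_regular h2 h3 (by rw [h1]; exact hKd)
  · intro h
    obtain ⟨rs', hm', hr', hd'⟩ := regular_of_cm h hKd
    have hle : rs'.length ≤ e + 2 := by rw [hd'] at hKd; exact_mod_cast hKd
    rcases hle.lt_or_eq with hlt | heq
    · exfalso
      have h1 := cm_dim G rs' _ hm' hr' hd' (n - rs'.length) (by omega)
      obtain ⟨eq⟩ := hkey (n - rs'.length) (by omega)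
      rw [supportDim_eq_of_equiv eq] at h1
      have h2 := dim_ext_le G (EE R R (c+1) M) (n - rs'.length + 2)
      rcases lt_or_ge rs'.length 2 with h3 | h3
      · have := h2.1 (by omega)
        rw [(supportDim_eq_bot_iff_subsingleton R _).mpr this] at h1
        exact absurd h1 (not_le.mpr (by exact_mod_cast WithBot.bot_lt_coe _))
      · have := h1.trans (h2.2 (rs'.length - 2) (by omega))
        have : rs'.length ≤ rs'.length - 2 := by exact_mod_cast this
        omega
    · obtain ⟨qs, h1, h2, h3⟩ := exists_regular G e (EE R R (c+1) M) (fun i hi => by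
        obtain ⟨i, rfl⟩ : ∃ i', i = i' + 2 := ⟨i - 2, by omega⟩
        exact sub_congr ⟨(hkey i (by omega)).some.symm⟩
          (ext_high G rs' _ hm' hr'.toIsWeaklyRegular _ (by omega)))
      exact cm_of_regular h2 h3 (by rw [h1]; exact hN.le)

lemma gor_of {n : ℕ} (h : IsGorensteinLocalRing R) (hn : ringKrullDim R = n) : Gor R n where
  noeth := h.1
  dim := hn
  van i hi := by
    have := (h.2 n hn).1 i hi
    exact (extModuleEquiv R i (ResidueField R) R).symm.toEquiv.subsingleton
  top := by
    obtain ⟨e⟩ := (h.2 n hn).2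
    exact ⟨(extModuleEquiv R n (ResidueField R) R).symm.trans e.toLinearEquiv⟩

end cm
end GorDual

/-- if `depth M = d-1` and `dim D^{d-1}(M) = d-2`, then `D^{d-1}(M)` is
Cohen–Macaulay iff the canonical module `K_M = D^d(M)` is Cohen–Macaulay. -/
theorem stmt_2
    (R : Type) [CommRing R] [IsLocalRing R] (hGor : IsGorensteinLocalRing R)
    (n : ℕ) (hn : ringKrullDim R = n)
    (A : Type) [CommRing A] [IsLocalRing A] [IsNoetherianRing A]
    (π : R →+* A) (hπ : Function.Surjective π)
    (M : Type) [AddCommGroup M] [Module A M] [Module R M] [Module.Finite A M]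
    (hcompat : ∀ (r : R) (m : M), π r • m = r • m)
    (d : ℕ) (hd : moduleDim A M = d) (hd2 : 2 ≤ d)
    (hdepth : moduleDepth A M = (d - 1 : ℕ))
    (hdimD : moduleDim R ↥(extModule R (n - (d - 1)) M R) = ((d - 2 : ℕ) : WithBot ℕ∞)) :
    IsCM R ↥(extModule R (n - (d - 1)) M R) ↔ IsCM R ↥(extModule R (n - d) M R) := by

  let : Algebra R A := π.toAlgebra
  have hs : Function.Surjective (algebraMap R A) := hπ
  have : IsScalarTower R A M := IsScalarTower.of_algebraMap_smul hcompat
  have : Module.Finite R A := Module.Finite.of_surjective (Algebra.linearMap R A) hs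
  have : Module.Finite R M := Module.Finite.trans A M
  have G := GorDual.gor_of hGor hn
  have hdim : Module.supportDim R M = d := (GorDual.supportDim_restrict hs M).trans hd
  have hdn : d ≤ n := by
    have := Module.supportDim_le_ringKrullDim R M
    rw [hdim, hn] at this
    exact_mod_cast this
  have hnt : Nontrivial M := by
    rw [← Module.supportDim_ne_bot_iff_nontrivial R M, hdim]
    exact_mod_cast WithBot.coe_ne_bot
  obtain ⟨rs, hl, hm, hr⟩ := GorDual.exists_of_depth hdepth
  obtain ⟨rs', rfl, hm'⟩ := GorDual.lift_list hs rs hm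
  obtain ⟨e, rfl⟩ : ∃ e, d = e + 2 := ⟨d - 2, by omega⟩
  obtain ⟨c, rfl⟩ : ∃ c, n = c + (e + 2) := ⟨n - (e + 2), by omega⟩
  have h1 : c + (e + 2) - (e + 2 - 1) = c + 1 := by omega
  have h2 : c + (e + 2) - (e + 2) = c := by omega
  rw [h1] at hdimD
  rw [h1, h2, GorDual.isCM_congr (GorDual.extModuleEquiv R (c+1) M R),
    GorDual.isCM_congr (GorDual.extModuleEquiv R c M R)]
  refine GorDual.main G M c e rfl hdim rs' (by simpa using hl) hm'
    ((RingTheory.Sequence.isWeaklyRegular_map_algebraMap_iff A M rs').mp hr.toIsWeaklyRegular) ?_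
  rw [← Module.supportDim_eq_of_equiv (GorDual.extModuleEquiv R (c+1) M R)]
  exact hdimD
end
end

section
/- Let (A,m) be a quotient of a Gorenstein local ring R of dimension n, M a finitely generated A-module with dim M = d ≥ 3 and depth(M) > 0, and suppose dim D^{d-1}(M) > 0. Let a ∈ m be a nonzerodivisor on M with a not in any associated prime of D^{d-1}(M) other than possibly m. Then K_M/aK_M ≅ K_{M/aM} if and only if depth K_M ≥ 3. In particular, if K_M is Cohen–Macaulay then K_{M/aM} is Cohen–Macaulay. -/
open CategoryTheory

noncomputable section

/-! ### Comparison of `extModule` with `Abelian.Ext` -/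

theorem extMk_zero_iff_deg_zero {R : Type} [CommRing R] {X Y : ModuleCat.{0} R}
    (P : ProjectiveResolution X)
    (f : P.complex.X 0 ⟶ Y) (hf : P.complex.d 1 0 ≫ f = 0) :
    P.extMk f 1 rfl hf = 0 ↔ f = 0 := by
  constructor
  · intro h
    simp only [← P.extEquivCohomologyClass.apply_eq_iff_eq,
      ProjectiveResolution.extEquivCohomologyClass_extMk,
      ProjectiveResolution.extEquivCohomologyClass_zero,
      CochainComplex.HomComplex.CohomologyClass.mk_eq_zero_iff] at h
    rw [CochainComplex.HomComplex.Cocycle.toSingleMk_mem_coboundaries_iff _ _ _ _ _ (1:ℤ)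
      (by lia)] at h
    obtain ⟨g, hg⟩ := h
    have : P.cochainComplex.d (-(0:ℕ)) 1 = 0 := by
      apply Limits.IsZero.eq_of_tgt
      exact P.cochainComplex.isZero_of_isStrictlyLE 0 1 (by lia)
    rw [this, Limits.zero_comp] at hg
    rw [← cancel_epi (P.cochainComplexXIso (-(0:ℕ)) 0 rfl).hom, ← hg, Limits.comp_zero]
  · rintro rfl; simp

theorem smul_extMk_aux {R : Type} [CommRing R] {X Y : ModuleCat.{0} R}
    (P : ProjectiveResolution X) (i : ℕ) (r : R)
    (f : P.complex.X i ⟶ Y) (hf : P.complex.d (i + 1) i ≫ f = 0) :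
    r • P.extMk f (i + 1) rfl hf = P.extMk (r • f) (i + 1) rfl (by simp [hf]) := by
  rw [Abelian.Ext.smul_eq_comp_mk₀, ProjectiveResolution.extMk_comp_mk₀]
  congr 1

/-- The map from cocycles to `Abelian.Ext`. -/
def cocycleToExt {R : Type} [CommRing R] {X : ModuleCat.{0} R}
    (P : ProjectiveResolution X) (Y : ModuleCat.{0} R) (i : ℕ) :
    LinearMap.ker (ModuleCat.ofHom (Linear.leftComp R Y (P.complex.d (i + 1) i))).hom →ₗ[R]
      Abelian.Ext X Y i where
  toFun f := P.extMk f.1 (i + 1) rfl f.2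
  map_add' f g := (P.add_extMk f.1 g.1 (i + 1) rfl f.2 g.2).symm
  map_smul' r f := (smul_extMk_aux P i r f.1 f.2).symm

theorem nonempty_extModule_equiv (R : Type) [CommRing R] (i : ℕ) (M N : Type)
    [AddCommGroup M] [Module R M] [AddCommGroup N] [Module R N] :
    Nonempty (↥(extModule R i M N) ≃ₗ[R]
      Abelian.Ext (ModuleCat.of R M) (ModuleCat.of R N) i) := by
  let P := projectiveResolution (ModuleCat.of R M)
  let Y := ModuleCat.of R N
  let K := P.complex.linearYonedaObj R Y
  have e1 : ↥(extModule R i M N) ≃ₗ[R] K.homology i :=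
    (P.isoExt (R := R) i Y).toLinearEquiv
  let S := K.sc' ((ComplexShape.up ℕ).prev i) i (i + 1)
  have e2 : K.homology i ≃ₗ[R] S.homology :=
    (HomologicalComplex.homologyMapIso (Iso.refl K) i ≪≫ ShortComplex.homologyMapIso
      (K.isoSc' ((ComplexShape.up ℕ).prev i) i (i + 1) rfl (by simp))).toLinearEquiv
  have e3 : S.homology ≃ₗ[R] S.moduleCatLeftHomologyData.H :=
    S.moduleCatHomologyIso.toLinearEquiv
  let φ : LinearMap.ker S.g.hom →ₗ[R] Abelian.Ext (ModuleCat.of R M) Y i := cocycleToExt P Y i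
  have hφ : Function.Surjective φ := by
    intro α
    obtain ⟨f, hf, rfl⟩ := P.extMk_surjective α (i + 1) rfl
    exact ⟨⟨f, hf⟩, rfl⟩
  have hker : LinearMap.range S.moduleCatToCycles = LinearMap.ker φ := by
    ext ⟨f, hf⟩
    rw [LinearMap.mem_ker, LinearMap.mem_range]
    change _ ↔ P.extMk f (i + 1) rfl hf = 0
    cases i with
    | zero =>
      refine Iff.trans ?_ (extMk_zero_iff_deg_zero P f hf).symm
      have h0 : K.d ((ComplexShape.up ℕ).prev 0) 0 = 0 := K.shape _ _ (by simp)
      constructor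
      · rintro ⟨y, hy⟩
        have h1 : (K.d ((ComplexShape.up ℕ).prev 0) 0).hom y = f := congrArg Subtype.val hy
        rw [h0] at h1
        exact h1.symm
      · intro h
        refine ⟨0, ?_⟩
        rw [map_zero]
        exact Subtype.ext h.symm
    | succ j =>
      refine Iff.trans ?_ (P.extMk_eq_zero_iff f (j + 1 + 1) rfl hf j rfl).symm
      have hp : (ComplexShape.up ℕ).prev (j + 1) = j := by simp
      have h2 : (∃ y, (K.d ((ComplexShape.up ℕ).prev (j+1)) (j+1)).hom y = f) ↔
          ∃ y, (K.d j (j+1)).hom y = f := by rw [hp]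
      refine Iff.trans ?_ (h2.trans Iff.rfl)
      constructor
      · rintro ⟨y, hy⟩
        exact ⟨y, congrArg Subtype.val hy⟩
      · rintro ⟨y, hy⟩
        exact ⟨y, Subtype.ext hy⟩
  have e4 : S.moduleCatLeftHomologyData.H ≃ₗ[R] Abelian.Ext (ModuleCat.of R M) Y i :=
    (Submodule.quotEquivOfEq _ _ hker).trans (φ.quotKerEquivOfSurjective hφ)
  exact ⟨((e1.trans e2).trans e3).trans e4⟩

/-! ### Long exact sequences -/

/-- Covariant vanishing: `Ext^i(N, X/x) = 0` -/
theorem ext_quot_subsingleton {R : Type} [CommRing R] {N X : Type} [AddCommGroup N] [Module R N]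
    [AddCommGroup X] [Module R X] {x : R} (hx : IsSMulRegular X x) (i : ℕ)
    (h0 : Subsingleton (Abelian.Ext (ModuleCat.of R N) (ModuleCat.of R X) i))
    (h1 : Subsingleton (Abelian.Ext (ModuleCat.of R N) (ModuleCat.of R X) (i + 1))) :
    Subsingleton (Abelian.Ext (ModuleCat.of R N) (ModuleCat.of R (QuotSMulTop x X)) i) := by
  have hS := IsSMulRegular.smulShortComplex_shortExact (M := ModuleCat.of R X) hx
  refine subsingleton_of_forall_eq 0 fun z => ?_
  obtain ⟨y, hy⟩ := Abelian.Ext.covariant_sequence_exact₃ (ModuleCat.of R N) hS z rfl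
    (Subsingleton.elim (α := Abelian.Ext (ModuleCat.of R N) (ModuleCat.of R X) (i + 1)) _ _)
  have : y = 0 := Subsingleton.elim (α := Abelian.Ext (ModuleCat.of R N) (ModuleCat.of R X) i) _ _
  rw [← hy, this, Abelian.Ext.zero_comp]; rfl

/-- The shift of degrees due to Rees. -/
theorem ext_rees_shift {R : Type} [CommRing R] {N X : Type} [AddCommGroup N] [Module R N]
    [AddCommGroup X] [Module R X] {x : R} (hx : IsSMulRegular X x)
    (hN : x ∈ Module.annihilator R N) (i : ℕ)
    (h0 : Subsingleton (Abelian.Ext (ModuleCat.of R N) (ModuleCat.of R X) i)) :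
    Nonempty (Abelian.Ext (ModuleCat.of R N) (ModuleCat.of R X) (i + 1) ≃ₗ[R]
      Abelian.Ext (ModuleCat.of R N) (ModuleCat.of R (QuotSMulTop x X)) i) := by
  have hS := IsSMulRegular.smulShortComplex_shortExact (M := ModuleCat.of R X) hx
  let δ : Abelian.Ext (ModuleCat.of R N) (ModuleCat.of R (QuotSMulTop x X)) i →ₗ[R]
      Abelian.Ext (ModuleCat.of R N) (ModuleCat.of R X) (i + 1) :=
    hS.extClass.postcompOfLinear R (ModuleCat.of R N) rfl
  refine ⟨(LinearEquiv.ofBijective δ ⟨?_, ?_⟩).symm⟩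
  · rw [injective_iff_map_eq_zero]
    intro z hz
    obtain ⟨y, hy⟩ := Abelian.Ext.covariant_sequence_exact₃ (ModuleCat.of R N) hS z rfl hz
    have : y = 0 := Subsingleton.elim (α := Abelian.Ext (ModuleCat.of R N) (ModuleCat.of R X) i) _ _
    rw [← hy, this, Abelian.Ext.zero_comp]; rfl
  · intro z
    refine Abelian.Ext.covariant_sequence_exact₁ (ModuleCat.of R N) hS z ?_ rfl
    have := Abelian.Ext.postcomp_smul_id_eq_zero_of_mem_annihilator
      (N := ModuleCat.of R N) (M := ModuleCat.of R X) hN (i + 1)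
    exact congrArg (fun f => f.hom z) this

theorem ext_hom_equiv {R : Type} [CommRing R] [IsLocalRing R] [IsNoetherianRing R]
    {N : Type} [AddCommGroup N] [Module R N] [Module.Finite R N] [Nontrivial N]
    (rs : List R) : ∀ {X : Type} [AddCommGroup X] [Module R X] [Module.Finite R X]
    (_ : RingTheory.Sequence.IsRegular X rs) (_ : ∀ r ∈ rs, r ∈ Module.annihilator R N),
    Nonempty (Abelian.Ext (ModuleCat.of R N) (ModuleCat.of R X) rs.length ≃ₗ[R]
      (N →ₗ[R] (X ⧸ (Ideal.ofList rs • ⊤ : Submodule R X)))) := by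
  induction rs with
  | nil =>
    intro X _ _ _ h _
    refine ⟨(Abelian.Ext.linearEquiv₀.trans ModuleCat.homLinearEquiv).trans
      (LinearEquiv.congrRight (Submodule.quotEquivOfEqBot _ ?_).symm)⟩
    simp
  | cons x rs ih =>
    intro X _ _ _ h hN
    have h' := (RingTheory.Sequence.isRegular_cons_iff X x rs).mp h
    obtain ⟨e1⟩ := ih h'.2 (fun r hr => hN r (List.mem_cons_of_mem _ hr))
    have hlt : Module.annihilator R N • (⊤ : Submodule R X) < ⊤ := by
      have : Nontrivial X := h.nontrivial
      refine lt_of_le_of_lt (Submodule.smul_mono_left (IsLocalRing.le_maximalIdeal ?_))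
        (lt_top_iff_ne_top.mpr ?_)
      · rw [Ne, Module.annihilator_eq_top_iff]; exact not_subsingleton N
      · intro h
        exact (Submodule.top_ne_ideal_smul_of_le_jacobson_annihilator
          (IsLocalRing.maximalIdeal_le_jacobson _)) h.symm
    have h0 : Subsingleton (Abelian.Ext (ModuleCat.of R N) (ModuleCat.of R X) rs.length) :=
      ModuleCat.subsingleton_ext_of_exists_isRegular (Module.annihilator R N) (ModuleCat.of R N)
        (by rw [Module.support_eq_zeroLocus]) (ModuleCat.of R X) hlt (x :: rs) hN h _ (by simp)
    obtain ⟨e2⟩ := ext_rees_shift h'.1 (hN x (by simp)) rs.length h0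
    exact ⟨(e2.trans e1).trans (LinearEquiv.congrRight
      (Submodule.quotOfListConsSMulTopEquivQuotSMulTopInner X x rs).symm)⟩

theorem ext_les {R : Type} [CommRing R] {M X : Type} [AddCommGroup M] [Module R M]
    [AddCommGroup X] [Module R X] {a : R} (ha : IsSMulRegular M a) (i : ℕ)
    (h0 : Subsingleton (Abelian.Ext (ModuleCat.of R (QuotSMulTop a M)) (ModuleCat.of R X) i)) :
    IsSMulRegular (Abelian.Ext (ModuleCat.of R M) (ModuleCat.of R X) i) a ∧
    ∃ (δ : Abelian.Ext (ModuleCat.of R M) (ModuleCat.of R X) i →ₗ[R]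
        Abelian.Ext (ModuleCat.of R (QuotSMulTop a M)) (ModuleCat.of R X) (i + 1))
      (ρ : Abelian.Ext (ModuleCat.of R (QuotSMulTop a M)) (ModuleCat.of R X) (i + 1) →ₗ[R]
        Abelian.Ext (ModuleCat.of R M) (ModuleCat.of R X) (i + 1)),
      (∀ z, δ z = 0 ↔ ∃ y, z = a • y) ∧ (∀ z, ρ z = 0 ↔ ∃ y, z = δ y) ∧
      (∀ z, a • ρ z = 0) := by
  have hS := IsSMulRegular.smulShortComplex_shortExact (M := ModuleCat.of R M) ha
  let δ : Abelian.Ext (ModuleCat.of R M) (ModuleCat.of R X) i →ₗ[R]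
        Abelian.Ext (ModuleCat.of R (QuotSMulTop a M)) (ModuleCat.of R X) (i + 1) :=
    hS.extClass.precompOfLinear R (ModuleCat.of R X) (add_comm 1 i)
  let ρ : ∀ j, Abelian.Ext (ModuleCat.of R (QuotSMulTop a M)) (ModuleCat.of R X) j →ₗ[R]
        Abelian.Ext (ModuleCat.of R M) (ModuleCat.of R X) j := fun j =>
    (Abelian.Ext.mk₀ ((ModuleCat.of R M).smulShortComplex a).g).precompOfLinear R
      (ModuleCat.of R X) (zero_add j)
  have hmul : ∀ j (z : Abelian.Ext (ModuleCat.of R M) (ModuleCat.of R X) j),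
      (Abelian.Ext.mk₀ ((ModuleCat.of R M).smulShortComplex a).f).comp z (zero_add j) = a • z := by
    intro j z
    change (Abelian.Ext.mk₀ (a • 𝟙 (ModuleCat.of R M))).comp z (zero_add j) = a • z
    rw [Abelian.Ext.mk₀_smul, Abelian.Ext.smul_comp, Abelian.Ext.mk₀_id_comp]
  refine ⟨?_, δ, ρ (i + 1), ?_, ?_, ?_⟩
  · rw [isSMulRegular_iff_right_eq_zero_of_smul]
    intro z hz
    rw [← hmul] at hz
    obtain ⟨y, hy⟩ := Abelian.Ext.contravariant_sequence_exact₂ hS (ModuleCat.of R X) z hz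
    have : y = 0 := Subsingleton.elim
      (α := Abelian.Ext (ModuleCat.of R (QuotSMulTop a M)) (ModuleCat.of R X) i) _ _
    rw [← hy, this, Abelian.Ext.comp_zero]; rfl
  · intro z
    constructor
    · intro hz
      obtain ⟨y, hy⟩ := Abelian.Ext.contravariant_sequence_exact₁ hS (ModuleCat.of R X) z
        (add_comm 1 i) hz
      exact ⟨y, hy.symm.trans (hmul i y)⟩
    · rintro ⟨y, rfl⟩
      rw [← hmul]
      exact hS.extClass_comp_assoc y (h := add_comm 1 i)
  · intro z
    constructor
    · intro hz
      obtain ⟨y, hy⟩ := Abelian.Ext.contravariant_sequence_exact₃ hS (ModuleCat.of R X) z hz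
        (add_comm 1 i)
      exact ⟨y, hy.symm⟩
    · rintro ⟨y, rfl⟩
      exact hS.comp_extClass_assoc y (add_comm 1 i)
  · intro z
    refine (hmul _ _).symm.trans ?_
    change (Abelian.Ext.mk₀ ((ModuleCat.of R M).smulShortComplex a).f).comp
      ((Abelian.Ext.mk₀ ((ModuleCat.of R M).smulShortComplex a).g).comp z (zero_add _))
        (zero_add _) = 0
    refine (Abelian.Ext.mk₀_comp_mk₀_assoc _ _ _).trans ?_
    rw [ShortComplex.zero, Abelian.Ext.mk₀_zero]
    apply Abelian.Ext.zero_comp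

/-! ### Regular sequences in the maximal ideal -/

/-- There is a regular sequence of length `t` in the maximal ideal. -/
def HasReg (R : Type) [CommRing R] [IsLocalRing R] (X : Type) [AddCommGroup X] [Module R X]
    (t : ℕ) : Prop :=
  ∃ rs : List R, rs.length = t ∧ (∀ r ∈ rs, r ∈ IsLocalRing.maximalIdeal R) ∧
    RingTheory.Sequence.IsRegular X rs

section HasRegLemmas

set_option linter.unusedSectionVars false
open scoped Pointwise

variable {R : Type} [CommRing R] [IsLocalRing R] [IsNoetherianRing R]
  {X : Type} [AddCommGroup X] [Module R X]
  {Y : Type} [AddCommGroup Y] [Module R Y]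

theorem HasReg.nontrivial {t : ℕ} (h : HasReg R X t) : Nontrivial X := by
  obtain ⟨rs, -, -, h⟩ := h
  exact h.nontrivial

theorem HasReg.congr {t : ℕ} (h : HasReg R X t) (e : X ≃ₗ[R] Y) : HasReg R Y t := by
  obtain ⟨rs, h1, h2, h3⟩ := h
  exact ⟨rs, h1, h2, (e.isRegular_congr rs).mp h3⟩

theorem max_smul_lt [Module.Finite R X] [Nontrivial X] :
    IsLocalRing.maximalIdeal R • (⊤ : Submodule R X) < ⊤ := by
  refine lt_top_iff_ne_top.mpr fun h => ?_
  exact (Submodule.top_ne_ideal_smul_of_le_jacobson_annihilator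
          (IsLocalRing.maximalIdeal_le_jacobson _)) h.symm

theorem support_residueField :
    Module.support R (IsLocalRing.ResidueField R) =
      PrimeSpectrum.zeroLocus (IsLocalRing.maximalIdeal R) := by
  rw [Module.support_eq_zeroLocus]
  congr 2
  exact Ideal.annihilator_quotient

theorem HasReg.ext [Module.Finite R X] {t : ℕ} (h : HasReg R X t) (i : ℕ) (hi : i < t) :
    Subsingleton (Abelian.Ext (ModuleCat.of R (IsLocalRing.ResidueField R))
      (ModuleCat.of R X) i) := by
  have := h.nontrivial
  obtain ⟨rs, rfl, h2, h3⟩ := h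
  exact ModuleCat.subsingleton_ext_of_exists_isRegular (IsLocalRing.maximalIdeal R) _
    support_residueField.le (ModuleCat.of R X) max_smul_lt rs h2 h3 i hi

theorem HasReg.of_ext [Module.Finite R X] [Nontrivial X] {t : ℕ}
    (h : ∀ i < t, Subsingleton (Abelian.Ext (ModuleCat.of R (IsLocalRing.ResidueField R))
      (ModuleCat.of R X) i)) : HasReg R X t :=
  ModuleCat.exists_isRegular_of_exists_subsingleton_ext (IsLocalRing.maximalIdeal R) t
    (ModuleCat.of R X) max_smul_lt _ support_residueField h

theorem quot_nontrivial [Module.Finite R X] [Nontrivial X] {x : R}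
    (hx : x ∈ IsLocalRing.maximalIdeal R) : Nontrivial (QuotSMulTop x X) := by
  refine Submodule.Quotient.nontrivial_iff.mpr fun h => ?_
  refine (max_smul_lt (R := R) (X := X)).ne (top_le_iff.mp (h.ge.trans ?_))
  rintro _ ⟨y, -, rfl⟩
  exact Submodule.smul_mem_smul hx trivial

theorem HasReg.quot [Module.Finite R X] {t : ℕ} (h : HasReg R X (t + 1)) {x : R}
    (hx : x ∈ IsLocalRing.maximalIdeal R) (hr : IsSMulRegular X x) :
    HasReg R (QuotSMulTop x X) t := by
  have := h.nontrivial
  have := quot_nontrivial (X := X) hx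
  exact HasReg.of_ext fun i hi => ext_quot_subsingleton hr i (h.ext i (by omega))
    (h.ext (i + 1) (by omega))

theorem HasReg.cons {t : ℕ} {x : R}
    (hx : x ∈ IsLocalRing.maximalIdeal R) (hr : IsSMulRegular X x)
    (h : HasReg R (QuotSMulTop x X) t) : HasReg R X (t + 1) := by
  obtain ⟨rs, h1, h2, h3⟩ := h
  refine ⟨x :: rs, by simp [h1], by simpa using ⟨hx, h2⟩, ?_⟩
  exact (RingTheory.Sequence.isRegular_cons_iff X x rs).mpr ⟨hr, h3⟩

theorem HasReg.mono [Module.Finite R X] {t s : ℕ} (h : HasReg R X t) (hs : s ≤ t) :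
    HasReg R X s := by
  have := h.nontrivial
  exact HasReg.of_ext fun i hi => h.ext i (by omega)

theorem exists_assoc_quot [Module.Finite R X] {x : R} (hx : x ∈ IsLocalRing.maximalIdeal R)
    (hr : IsSMulRegular X x) {p : Ideal R} (hp : p ∈ associatedPrimes R X) :
    ∃ q ∈ associatedPrimes R (QuotSMulTop x X), p < q := by
  obtain ⟨hpp, w, hw⟩ := isAssociatedPrime_iff.mp hp
  have hw0 : w ≠ 0 := by
    rintro rfl
    exact hpp.ne_top (by rw [hw]; ext; simp)
  have hmem : ∀ r, r ∈ p ↔ r • w = 0 := fun r => by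
    rw [hw, Submodule.mem_colon_singleton]; simp
  have hxp : x ∉ p := fun h => hw0 (isSMulRegular_iff_right_eq_zero_of_smul.mp hr w
    ((hmem x).mp h))
  let U : Submodule R X :=
    { carrier := {u | ∀ r ∈ p, r • u = 0}
      add_mem' := fun {a b} ha hb r hr => by rw [smul_add, ha r hr, hb r hr, add_zero]
      zero_mem' := fun r _ => smul_zero r
      smul_mem' := fun c u hu r hr => by rw [smul_comm, hu r hr, smul_zero] }
  have hU : ∃ u ∈ U, u ∉ x • (⊤ : Submodule R X) := by
    by_contra! hcon
    have : U ≤ IsLocalRing.maximalIdeal R • U := by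
      intro u hu
      obtain ⟨v, -, hv⟩ := hcon u hu
      have hv' : x • v = u := hv
      have hvU : v ∈ U := by
        intro r hr'
        refine isSMulRegular_iff_right_eq_zero_of_smul.mp hr _ ?_
        rw [smul_comm, hv']
        exact hu r hr'
      rw [← hv']
      exact Submodule.smul_mem_smul hx hvU
    have hbot := Submodule.eq_bot_of_le_smul_of_le_jacobson_bot (IsLocalRing.maximalIdeal R) U
      (IsNoetherian.noetherian U) this (IsLocalRing.maximalIdeal_le_jacobson _)
    have : w ∈ U := fun r hr => (hmem r).mp hr
    rw [hbot] at this
    exact hw0 (by simpa using this)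
  obtain ⟨u, hu, hux⟩ := hU
  obtain ⟨q, hq, hle⟩ := exists_le_isAssociatedPrime_of_isNoetherianRing R
    (Submodule.Quotient.mk u : QuotSMulTop x X)
    (fun h => hux ((Submodule.Quotient.mk_eq_zero _).mp h))
  have hle' : ∀ r : R, r • u ∈ x • (⊤ : Submodule R X) → r ∈ q := by
    intro r hr
    apply hle
    rw [Submodule.mem_colon_singleton, Submodule.mem_bot, ← Submodule.Quotient.mk_smul]
    exact (Submodule.Quotient.mk_eq_zero _).mpr hr
  refine ⟨q, hq, lt_of_le_of_ne (fun r hr => hle' r ?_) ?_⟩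
  · rw [hu r hr]; exact zero_mem _
  · rintro rfl
    exact hxp (hle' x ⟨u, trivial, rfl⟩)

theorem dim_quot_lt {p q : Ideal R} [p.IsPrime] (hpq : p < q) :
    ringKrullDim (R ⧸ q) + 1 ≤ ringKrullDim (R ⧸ p) := by
  obtain ⟨r, hrq, hrp⟩ := Set.exists_of_ssubset hpq
  refine ringKrullDim_succ_le_of_surjective (Ideal.Quotient.factor hpq.le)
    (Ideal.Quotient.factor_surjective hpq.le) (r := Ideal.Quotient.mk p r) ?_ ?_
  · refine mem_nonZeroDivisors_of_ne_zero fun h => hrp (Ideal.Quotient.eq_zero_iff_mem.mp h)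
  · rw [Ideal.Quotient.factor_mk]; exact Ideal.Quotient.eq_zero_iff_mem.mpr hrq

theorem le_dim_of_assoc {t : ℕ} : ∀ {X : Type} [AddCommGroup X] [Module R X] [Module.Finite R X]
    (_ : HasReg R X t) {p : Ideal R} (_ : p ∈ associatedPrimes R X),
    (t : WithBot ℕ∞) ≤ ringKrullDim (R ⧸ p) := by
  induction t with
  | zero =>
    intro X _ _ _ h p hp
    have := hp.isPrime
    simpa using (ringKrullDim_nonneg_of_nontrivial (R := R ⧸ p))
  | succ t ih =>
    intro X _ _ _ h p hp
    obtain ⟨rs, h1, h2, h3⟩ := h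
    match rs, h1, h2, h3 with
    | x :: rs, h1, h2, h3 =>
      rw [RingTheory.Sequence.isRegular_cons_iff] at h3
      have hx : x ∈ IsLocalRing.maximalIdeal R := h2 x (by simp)
      obtain ⟨q, hq, hlt⟩ := exists_assoc_quot hx h3.1 hp
      have := hp.isPrime
      have h4 := ih (X := QuotSMulTop x X)
        ⟨rs, by simpa using h1, fun r hr => h2 r (by simp [hr]), h3.2⟩ hq
      refine le_trans ?_ (dim_quot_lt hlt)
      push_cast
      gcongr

theorem exists_reg_mem [Module.Finite R X] {t e : ℕ} (hX : HasReg R X t) (I : Ideal R)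
    (hI : ringKrullDim (R ⧸ I) ≤ e) (het : e < t) : ∃ x ∈ I, IsSMulRegular X x := by
  by_contra! hcon
  obtain ⟨p, hp, hle⟩ := (I.subset_union_prime_finite (associatedPrimes.finite R X) (f := id)
    0 0 fun _ h _ _ ↦ h.isPrime).1 (by
      simp_rw [id, biUnion_associatedPrimes_eq_compl_regular]
      exact fun r hr => hcon r hr)
  have h1 := le_dim_of_assoc hX hp
  have h2 : ringKrullDim (R ⧸ p) ≤ ringKrullDim (R ⧸ I) :=
    ringKrullDim_le_of_surjective (Ideal.Quotient.factor hle) (Ideal.Quotient.factor_surjective hle)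
  have h3 : (t : WithBot ℕ∞) ≤ e := h1.trans (h2.trans hI)
  have h4 : t ≤ e := by exact_mod_cast h3
  omega

theorem exists_seq_mem {e : ℕ} (I : Ideal R) (hIm : I ≤ IsLocalRing.maximalIdeal R)
    (hI : ringKrullDim (R ⧸ I) ≤ e) (s : ℕ) : ∀ {X : Type} [AddCommGroup X] [Module R X]
    [Module.Finite R X] (_ : HasReg R X (e + s)),
    ∃ rs : List R, rs.length = s ∧ (∀ r ∈ rs, r ∈ I) ∧ RingTheory.Sequence.IsRegular X rs ∧
      HasReg R (X ⧸ (Ideal.ofList rs • ⊤ : Submodule R X)) e := by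
  induction s with
  | zero =>
    intro X _ _ _ h
    have := h.nontrivial
    refine ⟨[], rfl, by simp, by simp [RingTheory.Sequence.isRegular_iff], ?_⟩
    exact HasReg.congr h (Submodule.quotEquivOfEqBot _ (by simp)).symm
  | succ s ih =>
    intro X _ _ _ h
    obtain ⟨x, hxI, hx⟩ := exists_reg_mem h I hI (by omega)
    obtain ⟨rs, h1, h2, h3, h4⟩ := ih (HasReg.quot (t := e + s) h (hIm hxI) hx)
    refine ⟨x :: rs, by simp [h1], by simpa using ⟨hxI, h2⟩,
      (RingTheory.Sequence.isRegular_cons_iff X x rs).mpr ⟨hx, h3⟩, ?_⟩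
    exact h4.congr (Submodule.quotOfListConsSMulTopEquivQuotSMulTopInner X x rs).symm

end HasRegLemmas

/-! ### Duals -/

section DualLemmas

set_option linter.unusedSectionVars false
open scoped Pointwise

variable {R : Type} [CommRing R] [IsLocalRing R] [IsNoetherianRing R]
  {N : Type} [AddCommGroup N] [Module R N] [Module.Finite R N]
  {S : Type} [AddCommGroup S] [Module R S] [Module.Finite R S]

theorem dim_add_cancel {x : WithBot ℕ∞} {a b : ℕ}
    (h : x + (b : WithBot ℕ∞) = (a : WithBot ℕ∞) + (b : WithBot ℕ∞)) : x = a := by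
  induction x using WithBot.recBotCoe with
  | bot =>
    rw [WithBot.bot_add] at h
    exact absurd h WithBot.bot_ne_coe
  | coe x =>
    induction x using ENat.recTopCoe with
    | top =>
      have h' : (⊤ : ℕ∞) + (b : ℕ∞) = (a : ℕ∞) + (b : ℕ∞) := WithBot.coe_injective h
      rw [top_add] at h'
      exact absurd h' (ENat.top_ne_natCast (a + b))
    | coe x =>
      have h' : x + b = a + b := by exact_mod_cast h
      have : x = a := by omega
      rw [this]; rfl

theorem exists_prime_dim {e : ℕ} (h : Module.supportDim R N = e) :
    ∃ p : Ideal R, p.IsPrime ∧ Module.annihilator R N ≤ p ∧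
      (e : WithBot ℕ∞) ≤ ringKrullDim (R ⧸ p) := by
  obtain ⟨l, hl⟩ := Order.le_krullDim_iff.mp (le_of_eq h.symm)
  refine ⟨l.head.1.asIdeal, l.head.1.isPrime, Module.mem_support_iff_of_finite.mp l.head.2, ?_⟩
  rw [ringKrullDim_quotient]
  refine Order.le_krullDim_iff.mpr ⟨⟨l.length, fun i => ⟨(l i).1, ?_⟩, fun i => ?_⟩, hl⟩
  · rw [PrimeSpectrum.mem_zeroLocus]
    exact (l.monotone (Fin.zero_le i) : l 0 ≤ l i)
  · exact l.step i

theorem hom_reg1 (hS : HasReg R S 1) :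
    ∃ y ∈ IsLocalRing.maximalIdeal R, IsSMulRegular (N →ₗ[R] S) y := by
  obtain ⟨rs, h1, h2, h3⟩ := hS
  match rs, h1, h2, h3 with
  | [y], h1, h2, h3 =>
    rw [RingTheory.Sequence.isRegular_cons_iff] at h3
    refine ⟨y, h2 y (by simp), ?_⟩
    intro f g hfg
    ext n
    exact h3.1 (LinearMap.congr_fun hfg n)

theorem hom_reg2 (hS : HasReg R S 2) [Nontrivial (N →ₗ[R] S)] :
    HasReg R (N →ₗ[R] S) 2 := by
  obtain ⟨rs, h1, h2, h3⟩ := hS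
  match rs, h1, h2, h3 with
  | [y, z], h1, h2, h3 =>
    rw [RingTheory.Sequence.isRegular_cons_iff, RingTheory.Sequence.isRegular_cons_iff] at h3
    have hy : y ∈ IsLocalRing.maximalIdeal R := h2 y (by simp)
    have hz : z ∈ IsLocalRing.maximalIdeal R := h2 z (by simp)
    have hyr : IsSMulRegular (N →ₗ[R] S) y := by
      intro f g hfg
      ext n
      exact h3.1 (LinearMap.congr_fun hfg n)
    have := quot_nontrivial (X := N →ₗ[R] S) hy
    refine HasReg.cons (t := 1) hy hyr (HasReg.cons (t := 0) hz ?_ ?_)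
    · rw [isSMulRegular_iff_right_eq_zero_of_smul]
      intro f hf
      obtain ⟨f, rfl⟩ := Submodule.Quotient.mk_surjective _ f
      rw [← Submodule.Quotient.mk_smul, Submodule.Quotient.mk_eq_zero] at hf
      obtain ⟨g, -, hg⟩ := hf
      have hg' : y • g = z • f := hg
      have key : ∀ n, ∃ s : S, y • s = f n := by
        intro n
        have h0 : z • (Submodule.Quotient.mk (f n) : QuotSMulTop y S) = 0 := by
          rw [← Submodule.Quotient.mk_smul, Submodule.Quotient.mk_eq_zero]
          exact ⟨g n, trivial, LinearMap.congr_fun hg' n⟩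
        have h0' := isSMulRegular_iff_right_eq_zero_of_smul.mp h3.2.1 _ h0
        rw [Submodule.Quotient.mk_eq_zero] at h0'
        obtain ⟨s, -, hs⟩ := h0'
        exact ⟨s, hs⟩
      choose F hF using key
      rw [Submodule.Quotient.mk_eq_zero]
      refine ⟨⟨⟨F, fun a b => h3.1 ?_⟩, fun r a => h3.1 ?_⟩, trivial, ?_⟩
      · simp only [smul_add, hF, map_add]
      · simp only [hF, map_smul, RingHom.id_apply]
        rw [smul_comm, hF]
      · ext n
        exact hF n
    · have := quot_nontrivial (X := QuotSMulTop y (N →ₗ[R] S)) hz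
      exact ⟨[], rfl, by simp, by simp [RingTheory.Sequence.isRegular_iff]⟩

/-- Choice of a regular sequence in the annihilator of `N`. -/
theorem dual_setup [Nontrivial N] {n e : ℕ} (hn : ringKrullDim R = n) (hR : HasReg R R n)
    (he : Module.supportDim R N = e) :
    e ≤ n ∧ ∃ rs : List R, rs.length = n - e ∧ (∀ r ∈ rs, r ∈ Module.annihilator R N) ∧
      RingTheory.Sequence.IsRegular R rs ∧
      HasReg R (R ⧸ (Ideal.ofList rs • ⊤ : Submodule R R)) e := by
  have hle : e ≤ n := by
    have := Module.supportDim_le_ringKrullDim R N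
    rw [he, hn] at this
    exact_mod_cast this
  refine ⟨hle, exists_seq_mem (Module.annihilator R N) (IsLocalRing.le_maximalIdeal ?_) ?_ (n - e)
    (X := R) ?_⟩
  · rw [Ne, Module.annihilator_eq_top_iff]; exact not_subsingleton N
  · rw [← Module.supportDim_eq_ringKrullDim_quotient_annihilator, he]
  · rwa [Nat.add_sub_cancel' hle]

theorem hom_dim [Nontrivial N] {n e : ℕ} (hn : ringKrullDim R = n)
    (he : Module.supportDim R N = e) (hen : e ≤ n) (rs : List R) (hl : rs.length = n - e)
    (hann : ∀ r ∈ rs, r ∈ Module.annihilator R N) (hreg : RingTheory.Sequence.IsRegular R rs) :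
    Module.supportDim R (N →ₗ[R] (R ⧸ (Ideal.ofList rs • ⊤ : Submodule R R))) = e := by
  obtain ⟨p, hp, hNp, hdim⟩ := exists_prime_dim he
  set S := R ⧸ (Ideal.ofList rs • ⊤ : Submodule R R) with hS
  have hSd : Module.supportDim R S = e := by
    have h1 := Module.supportDim_add_length_eq_supportDim_of_isRegular rs hreg
    rw [Module.supportDim_self_eq_ringKrullDim, hn, hl] at h1
    have h2 : (n : WithBot ℕ∞) = (e : WithBot ℕ∞) + ((n - e : ℕ) : WithBot ℕ∞) := by
      norm_cast; omega
    rw [h2] at h1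
    exact dim_add_cancel h1
  have hSann : Module.annihilator R S = Ideal.ofList rs := by
    refine Ideal.annihilator_quotient.trans ?_
    rw [smul_eq_mul, Ideal.mul_top]
  have hSp : Module.annihilator R S ≤ p := by
    rw [hSann]
    refine (Ideal.span_le.mpr ?_).trans hNp
    exact hann
  have hmin : p ∈ (Module.annihilator R S).minimalPrimes := by
    obtain ⟨q, hq, hqp⟩ := Ideal.exists_minimalPrimes_le hSp
    rcases hqp.eq_or_lt with rfl | hlt
    · exact hq
    · exfalso
      have := hq.isPrime
      have h1 := dim_quot_lt hlt
      have h2 : ringKrullDim (R ⧸ q) ≤ e := by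
        rw [← hSd, Module.supportDim_eq_ringKrullDim_quotient_annihilator]
        exact ringKrullDim_le_of_surjective (Ideal.Quotient.factor hq.1.2)
          (Ideal.Quotient.factor_surjective hq.1.2)
      have h3 : (e : WithBot ℕ∞) + 1 ≤ e := le_trans (by gcongr) (h1.trans h2)
      have h4 : e + 1 ≤ e := by exact_mod_cast h3
      omega
  have hass := Module.associatedPrimes.minimalPrimes_annihilator_subset_associatedPrimes R S hmin
  obtain ⟨-, ι, hι⟩ :=
    (isAssociatedPrime_iff_exists_injective_linearMap _ _).mp hass
  have hne : Nontrivial (N →ₗ[R] R ⧸ p) := by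
    rw [← not_subsingleton_iff_nontrivial, IsSMulRegular.subsingleton_linearMap_iff]
    rintro ⟨r, hr, hreg⟩
    have h1 : r • (1 : R ⧸ p) = 0 := by
      rw [Algebra.smul_def, mul_one]
      exact Ideal.Quotient.eq_zero_iff_mem.mpr (hNp hr)
    exact one_ne_zero (isSMulRegular_iff_right_eq_zero_of_smul.mp hreg _ h1)
  obtain ⟨f, hf⟩ := exists_ne (0 : N →ₗ[R] R ⧸ p)
  rw [Module.supportDim_eq_ringKrullDim_quotient_annihilator]
  apply le_antisymm
  · rw [← he, Module.supportDim_eq_ringKrullDim_quotient_annihilator]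
    have hle : Module.annihilator R N ≤ Module.annihilator R (N →ₗ[R] S) := by
      intro r hr
      rw [Module.mem_annihilator] at hr ⊢
      intro f
      ext n
      rw [LinearMap.smul_apply, ← map_smul, hr, map_zero, LinearMap.zero_apply]
    exact ringKrullDim_le_of_surjective (Ideal.Quotient.factor hle)
      (Ideal.Quotient.factor_surjective hle)
  · refine hdim.trans ?_
    have hle : Module.annihilator R (N →ₗ[R] S) ≤ p := by
      intro r hr
      obtain ⟨n, hn⟩ : ∃ n, f n ≠ 0 := by
        by_contra! h
        exact hf (LinearMap.ext h)
      have h1 := LinearMap.congr_fun (Module.mem_annihilator.mp hr (ι.comp f)) n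
      have h2 : r • f n = 0 := hι (by simpa using h1)
      rw [Algebra.smul_def] at h2
      exact Ideal.Quotient.eq_zero_iff_mem.mp ((mul_eq_zero.mp h2).resolve_right hn)
    exact ringKrullDim_le_of_surjective (Ideal.Quotient.factor hle)
      (Ideal.Quotient.factor_surjective hle)

/-- Properties of the canonical module `Ext^{n-e}(N,R)`. -/
theorem canonical_props [Nontrivial N] {n e : ℕ} (hn : ringKrullDim R = n) (hR : HasReg R R n)
    (he : Module.supportDim R N = e) (h2 : 2 ≤ e) :
    e ≤ n ∧
    (∀ i < n - e, Subsingleton (Abelian.Ext (ModuleCat.of R N) (ModuleCat.of R R) i)) ∧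
    HasReg R (Abelian.Ext (ModuleCat.of R N) (ModuleCat.of R R) (n - e)) 2 ∧
    Module.supportDim R (Abelian.Ext (ModuleCat.of R N) (ModuleCat.of R R) (n - e)) = e := by
  obtain ⟨hen, rs, hl, hann, hreg, hS⟩ := dual_setup hn hR he
  have hlt : Module.annihilator R N • (⊤ : Submodule R R) < ⊤ := by
    refine lt_of_le_of_lt (Submodule.smul_mono_left (IsLocalRing.le_maximalIdeal ?_))
      (max_smul_lt (R := R) (X := R))
    rw [Ne, Module.annihilator_eq_top_iff]; exact not_subsingleton N
  have hvan := ModuleCat.subsingleton_ext_of_exists_isRegular (Module.annihilator R N)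
    (ModuleCat.of R N) (by rw [Module.support_eq_zeroLocus]) (ModuleCat.of R R) hlt rs hann hreg
  obtain ⟨E⟩ := ext_hom_equiv (N := N) rs hreg hann
  have hdim := hom_dim hn he hen rs hl hann hreg
  have hnt : Nontrivial (N →ₗ[R] (R ⧸ (Ideal.ofList rs • ⊤ : Submodule R R))) := by
    by_contra hcon
    rw [not_nontrivial_iff_subsingleton] at hcon
    rw [Module.supportDim_eq_bot_of_subsingleton] at hdim
    exact WithBot.bot_ne_coe hdim
  have hr2 := hom_reg2 (N := N) (hS.mono h2)
  rw [hl] at E hvan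
  exact ⟨hen, hvan, hr2.congr E.symm, (Module.supportDim_eq_of_equiv E).trans hdim⟩

end DualLemmas

/-! ### The main argument -/

section MainArgument

set_option linter.unusedSectionVars false
open scoped Pointwise

variable {R : Type} [CommRing R] [IsLocalRing R] [IsNoetherianRing R]

theorem mem_of_max_smul_mem {Z : Type} [AddCommGroup Z] [Module R Z] (Q : Submodule R Z)
    (hQ : HasReg R Q 2) (hZ : HasReg R Z 2) (z : Z)
    (hz : ∀ r ∈ IsLocalRing.maximalIdeal R, r • z ∈ Q) : z ∈ Q := by
  obtain ⟨rs, h1, h2, h3⟩ := hQ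
  obtain ⟨rs', h1', h2', h3'⟩ := hZ
  match rs, h1, h2, h3, rs', h1', h2', h3' with
  | [x, y], h1, h2, h3, [w, w'], h1', h2', h3' =>
    rw [RingTheory.Sequence.isRegular_cons_iff, RingTheory.Sequence.isRegular_cons_iff] at h3
    rw [RingTheory.Sequence.isRegular_cons_iff] at h3'
    have hx : x ∈ IsLocalRing.maximalIdeal R := h2 x (by simp)
    have hy : y ∈ IsLocalRing.maximalIdeal R := h2 y (by simp)
    have hw : w ∈ IsLocalRing.maximalIdeal R := h2' w (by simp)
    let q : Q := ⟨x • z, hz x hx⟩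
    have hq0 : y • (Submodule.Quotient.mk q : QuotSMulTop x Q) = 0 := by
      rw [← Submodule.Quotient.mk_smul, Submodule.Quotient.mk_eq_zero]
      exact ⟨⟨y • z, hz y hy⟩, trivial, Subtype.ext (smul_comm x y z)⟩
    have hq1 := isSMulRegular_iff_right_eq_zero_of_smul.mp h3.2.1 _ hq0
    rw [Submodule.Quotient.mk_eq_zero] at hq1
    obtain ⟨q', -, hq'⟩ := hq1
    have hq2 : x • (q' : Z) = x • z := congrArg Subtype.val hq'
    have hwt : w • (z - q') ∈ Q := by
      rw [smul_sub]
      exact Q.sub_mem (hz w hw) (Q.smul_mem w q'.2)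
    have hxt : x • (⟨w • (z - q'), hwt⟩ : Q) = 0 := by
      apply Subtype.ext
      change x • w • (z - (q' : Z)) = 0
      rw [smul_comm, smul_sub x, hq2, sub_self, smul_zero]
    have hwt0 := congrArg Subtype.val
      (isSMulRegular_iff_right_eq_zero_of_smul.mp h3.1 _ hxt)
    have ht0 := isSMulRegular_iff_right_eq_zero_of_smul.mp h3'.1 _ hwt0
    rw [sub_eq_zero.mp ht0]
    exact q'.2

theorem core_iff {K Z D : Type} [AddCommGroup K] [Module R K] [Module.Finite R K]
    [AddCommGroup Z] [Module R Z] [AddCommGroup D] [Module R D]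
    {a : R} (ha : a ∈ IsLocalRing.maximalIdeal R) (hreg : IsSMulRegular K a)
    (hZ : HasReg R Z 2)
    (hass : ∀ P ∈ associatedPrimes R D, P ≠ IsLocalRing.maximalIdeal R → a ∉ P)
    (δ : K →ₗ[R] Z) (ρ : Z →ₗ[R] D)
    (hδ : ∀ z, δ z = 0 ↔ ∃ y, z = a • y) (hρ : ∀ z, ρ z = 0 ↔ ∃ y, z = δ y)
    (haρ : ∀ z, a • ρ z = 0) :
    Nonempty (QuotSMulTop a K ≃ₗ[R] Z) ↔ HasReg R K 3 := by
  constructor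
  · rintro ⟨e⟩
    exact HasReg.cons ha hreg (hZ.congr e.symm)
  · intro h3
    have hker : (a • ⊤ : Submodule R K) = LinearMap.ker δ := by
      ext z
      rw [LinearMap.mem_ker, hδ]
      constructor
      · rintro ⟨y, -, hy⟩
        exact ⟨y, hy.symm⟩
      · rintro ⟨y, rfl⟩
        exact ⟨y, trivial, rfl⟩
    let E : QuotSMulTop a K ≃ₗ[R] LinearMap.range δ :=
      (Submodule.quotEquivOfEq _ _ hker).trans δ.quotKerEquivRange
    have hQ : HasReg R (LinearMap.range δ) 2 := (HasReg.quot (t := 2) h3 ha hreg).congr E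
    have hsurj : LinearMap.range δ = ⊤ := by
      by_contra hne
      have hex : ∃ z, ρ z ≠ 0 := by
        by_contra! hcon
        apply hne
        rw [eq_top_iff]
        intro z _
        obtain ⟨y, hy⟩ := (hρ z).mp (hcon z)
        exact ⟨y, hy.symm⟩
      obtain ⟨z, hz⟩ := hex
      obtain ⟨P, hP, -⟩ := exists_le_isAssociatedPrime_of_isNoetherianRing R
        (⟨ρ z, z, rfl⟩ : LinearMap.range ρ) (fun h => hz (congrArg Subtype.val h))
      have hPD : P ∈ associatedPrimes R D :=
        hP.map_of_injective (LinearMap.range ρ).subtype Subtype.val_injective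
      obtain ⟨hPp, ⟨_, u, rfl⟩, hw⟩ := isAssociatedPrime_iff.mp hP
      have hmem : ∀ r, r ∈ P ↔ r • ρ u = 0 := fun r => by
        rw [hw, Submodule.mem_colon_singleton, Submodule.mem_bot, ← Subtype.coe_inj]
        rfl
      have haP : a ∈ P := (hmem a).mpr (haρ u)
      have hPm : P = IsLocalRing.maximalIdeal R := by
        by_contra hcon
        exact hass P hPD hcon haP
      have hu : u ∈ LinearMap.range δ := by
        refine mem_of_max_smul_mem _ hQ hZ u fun r hr => ?_
        rw [← hPm, hmem, ← map_smul, hρ] at hr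
        obtain ⟨y, hy⟩ := hr
        exact ⟨y, hy.symm⟩
      obtain ⟨y, hy⟩ := hu
      have : ρ u = 0 := (hρ u).mpr ⟨y, hy.symm⟩
      apply hPp.ne_top
      rw [Ideal.eq_top_iff_one, hmem, this, smul_zero]
    exact ⟨E.trans ((LinearEquiv.ofEq _ _ hsurj).trans Submodule.topEquiv)⟩

theorem le_depth_iff {X : Type} [AddCommGroup X] [Module R X] [Module.Finite R X] {t : ℕ}
    (ht : 0 < t) : (t : ℕ∞) ≤ moduleDepth R X ↔ HasReg R X t := by
  constructor
  · intro h
    by_contra hcon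
    have hle : moduleDepth R X ≤ ((t - 1 : ℕ) : ℕ∞) := by
      refine sSup_le ?_
      rintro _ ⟨rs, rfl, h1, h2⟩
      by_contra hlt
      have hlt' : t - 1 < rs.length := by exact_mod_cast not_le.mp hlt
      exact hcon (HasReg.mono ⟨rs, rfl, h1, h2⟩ (by omega))
    have h4 : (t : ℕ∞) ≤ ((t - 1 : ℕ) : ℕ∞) := h.trans hle
    have h5 : t ≤ t - 1 := by exact_mod_cast h4
    omega
  · rintro ⟨rs, rfl, h1, h2⟩
    exact le_sSup ⟨rs, rfl, h1, h2⟩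

theorem isCM_of {X : Type} [AddCommGroup X] [Module R X] [Module.Finite R X] {e : ℕ}
    (hd : Module.supportDim R X = e) (he : 0 < e) (h : HasReg R X e) : IsCM R X := by
  refine Or.inr ?_
  have h1 : moduleDepth R X = (e : ℕ∞) := by
    refine le_antisymm (sSup_le ?_) ((le_depth_iff he).mpr h)
    rintro _ ⟨rs, rfl, h1, h2⟩
    have h3 := Module.supportDim_add_length_eq_supportDim_of_isRegular rs h2
    rw [hd] at h3
    have hnt : Nontrivial (X ⧸ (Ideal.ofList rs • ⊤ : Submodule R X)) := by
      exact Submodule.Quotient.nontrivial_iff.mpr h2.top_ne_smul.symm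
    have h4 : 0 ≤ Module.supportDim R (X ⧸ (Ideal.ofList rs • ⊤ : Submodule R X)) := by
      rw [Module.supportDim_eq_ringKrullDim_quotient_annihilator]
      have : Nontrivial (R ⧸ Module.annihilator R
          (X ⧸ (Ideal.ofList rs • ⊤ : Submodule R X))) := by
        refine Ideal.Quotient.nontrivial_iff.mpr ?_
        rw [Ne, Module.annihilator_eq_top_iff]; exact not_subsingleton _
      exact ringKrullDim_nonneg_of_nontrivial
    have h5 : (rs.length : WithBot ℕ∞) ≤ e := by
      rw [← h3]
      exact le_add_of_nonneg_left h4
    exact_mod_cast h5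
  rw [h1]
  exact hd

theorem hasReg_of_isCM {X : Type} [AddCommGroup X] [Module R X] [Module.Finite R X] {e : ℕ}
    (hd : Module.supportDim R X = e) (he : 0 < e) (h : IsCM R X) : HasReg R X e := by
  rcases h with h | h
  · rw [Module.supportDim_eq_bot_of_subsingleton] at hd
    exact absurd hd WithBot.bot_ne_coe
  · rw [← le_depth_iff he]
    have h1 : (moduleDepth R X : WithBot ℕ∞) = ((e : ℕ∞) : WithBot ℕ∞) := h.symm.trans hd
    exact (WithBot.coe_injective h1).ge

theorem supportDim_restrict {A : Type} [CommRing A] (π : R →+* A)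
    (hπ : Function.Surjective π) (M : Type) [AddCommGroup M] [Module A M] [Module R M]
    [Module.Finite A M] (hcompat : ∀ (r : R) (m : M), π r • m = r • m) :
    Module.Finite R M ∧ Module.supportDim R M = Module.supportDim A M := by
  have hfin : Module.Finite R M := by
    let _ := π.toAlgebra
    have : IsScalarTower R A M := ⟨fun r b m => by
      rw [Algebra.smul_def, mul_smul]; exact hcompat r _⟩
    have : Module.Finite R A := Module.Finite.of_surjective (Algebra.linearMap R A) hπ
    exact Module.Finite.trans A M
  refine ⟨hfin, ?_⟩
  rw [Module.supportDim_eq_ringKrullDim_quotient_annihilator,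
    Module.supportDim_eq_ringKrullDim_quotient_annihilator]
  have hco : Module.annihilator R M = (Module.annihilator A M).comap π := by
    ext r
    simp [Module.mem_annihilator, hcompat]
  refine RingEquiv.ringKrullDim (RingEquiv.ofBijective
    (Ideal.quotientMap (Module.annihilator A M) π hco.le) ⟨?_, ?_⟩)
  · exact Ideal.quotientMap_injective' hco.ge
  · exact Ideal.quotientMap_surjective hπ

end MainArgument

/-- for `a ∈ m` a nonzerodivisor on `M` avoiding all associated primes of
`D^{d-1}(M)` except possibly `m`, one has `K_M/aK_M ≅ K_{M/aM}` iff `depth K_M ≥ 3`;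
in particular if `K_M` is Cohen–Macaulay then so is `K_{M/aM}`. -/
theorem stmt_3
    (R : Type) [CommRing R] [IsLocalRing R] (hGor : IsGorensteinLocalRing R)
    (n : ℕ) (hn : ringKrullDim R = n)
    (A : Type) [CommRing A] [IsLocalRing A] [IsNoetherianRing A]
    (π : R →+* A) (hπ : Function.Surjective π)
    (M : Type) [AddCommGroup M] [Module A M] [Module R M] [Module.Finite A M]
    (hcompat : ∀ (r : R) (m : M), π r • m = r • m)
    (d : ℕ) (hd : moduleDim A M = d) (hd3 : 3 ≤ d)
    (hdepth : 0 < moduleDepth A M)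
    (hdimD : 0 < moduleDim R ↥(extModule R (n - (d - 1)) M R))
    (a : R) (ha : a ∈ IsLocalRing.maximalIdeal R)
    (hreg : IsSMulRegular M a)
    (hass : ∀ P ∈ associatedPrimes R ↥(extModule R (n - (d - 1)) M R),
      P ≠ IsLocalRing.maximalIdeal R → a ∉ P) :
    (Nonempty ((QuotSMulTop a ↥(extModule R (n - d) M R)) ≃ₗ[R]
        ↥(extModule R (n - (d - 1)) (QuotSMulTop a M) R)) ↔
      3 ≤ moduleDepth R ↥(extModule R (n - d) M R)) ∧
    (IsCM R ↥(extModule R (n - d) M R) →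
      IsCM R ↥(extModule R (n - (d - 1)) (QuotSMulTop a M) R)) := by
  have hNoeth : IsNoetherianRing R := hGor.1
  obtain ⟨hext, -⟩ := hGor.2 n hn
  -- the ring has depth `n`
  have hR : HasReg R R n := HasReg.of_ext fun i hi => by
    obtain ⟨e⟩ := nonempty_extModule_equiv R i (IsLocalRing.ResidueField R) R
    have := hext i (by omega)
    exact e.symm.toEquiv.subsingleton
  obtain ⟨hfin, hdim⟩ := supportDim_restrict π hπ M hcompat
  have hdM : Module.supportDim R M = d := hdim.trans hd
  have hMnt : Nontrivial M := by
    by_contra hcon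
    rw [not_nontrivial_iff_subsingleton] at hcon
    rw [Module.supportDim_eq_bot_of_subsingleton] at hdM
    exact WithBot.bot_ne_coe hdM
  have hQnt : Nontrivial (QuotSMulTop a M) := quot_nontrivial ha
  have hdQ : Module.supportDim R (QuotSMulTop a M) = (d - 1 : ℕ) := by
    have h1 := Module.supportDim_quotSMulTop_succ_eq_supportDim hreg ha
    rw [hdM] at h1
    refine dim_add_cancel (b := 1) ?_
    have h2 : (d : WithBot ℕ∞) = ((d - 1 : ℕ) : WithBot ℕ∞) + ((1 : ℕ) : WithBot ℕ∞) := by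
      norm_cast; omega
    rw [← h2, ← h1]
    norm_cast
  obtain ⟨hdn, -, -, hdimK⟩ := canonical_props hn hR hdM (by omega)
  obtain ⟨-, hvan, hZ2, hdimZ⟩ := canonical_props hn hR hdQ (by omega)
  have hidx : n - (d - 1) = n - d + 1 := by omega
  rw [hidx] at hass hvan hZ2 hdimZ ⊢
  obtain ⟨hregK, δ, ρ, hδ, hρ, haρ⟩ :=
    ext_les (X := R) hreg (n - d) (hvan (n - d) (by omega))
  obtain ⟨eK⟩ := nonempty_extModule_equiv R (n - d) M R
  obtain ⟨eZ⟩ := nonempty_extModule_equiv R (n - d + 1) (QuotSMulTop a M) R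
  obtain ⟨eD⟩ := nonempty_extModule_equiv R (n - d + 1) M R
  have hassD : ∀ P ∈ associatedPrimes R
      (Abelian.Ext (ModuleCat.of R M) (ModuleCat.of R R) (n - d + 1)),
      P ≠ IsLocalRing.maximalIdeal R → a ∉ P := fun P hP =>
    hass P (IsAssociatedPrime.map_of_injective (f := eD.symm.toLinearMap) hP eD.symm.injective)
  have hcore := core_iff ha hregK hZ2 hassD δ ρ hδ hρ haρ
  have hfinK : Module.Finite R ↥(extModule R (n - d) M R) := Module.Finite.equiv eK.symm
  have hfinZ : Module.Finite R ↥(extModule R (n - d + 1) (QuotSMulTop a M) R) :=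
    Module.Finite.equiv eZ.symm
  have eKa := QuotSMulTop.congr a eK
  have hdK : Module.supportDim R ↥(extModule R (n - d) M R) = d :=
    (Module.supportDim_eq_of_equiv eK).trans hdimK
  have hdZ : Module.supportDim R ↥(extModule R (n - d + 1) (QuotSMulTop a M) R) =
      (d - 1 : ℕ) := (Module.supportDim_eq_of_equiv eZ).trans hdimZ
  refine ⟨?_, fun hCM => ?_⟩
  · have h3 : (3 ≤ moduleDepth R ↥(extModule R (n - d) M R)) ↔
        HasReg R ↥(extModule R (n - d) M R) 3 := le_depth_iff (by norm_num)
    rw [h3]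
    constructor
    · rintro ⟨e⟩
      exact (hcore.mp ⟨(eKa.symm.trans e).trans eZ⟩).congr eK.symm
    · intro h
      obtain ⟨e⟩ := hcore.mpr (h.congr eK)
      exact ⟨(eKa.trans e).trans eZ.symm⟩
  · have hK := (hasReg_of_isCM hdK (by omega) hCM).congr eK
    obtain ⟨e⟩ := hcore.mpr (hK.mono hd3)
    obtain ⟨d', rfl⟩ : ∃ d', d = d' + 1 := ⟨d - 1, by omega⟩
    have hZ := ((HasReg.quot hK ha hregK).congr e).congr eZ.symm
    exact isCM_of hdZ (by omega) hZ
end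
end
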